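/- Let X be a shift space with language 𝓛 = 𝓛(X), let φ : X → ℝ be strictly positive and continuous, and let dim_φ denote Hausdorff dimension with respect to the metric d_φ. Suppose 𝓖 ⊂ 𝓛 has (W)-specification and 𝓛 is edit approachable by 𝓖. Then for any continuous ψ : X → ℝ and α ∈ ℝ, dim_φ(X(ψ,α)) = sup{ h_μ(σ)/∫ φ dμ : μ ∈ M_σ(X), ∫ ψ dμ = α }. -/

import Mathlib

open MeasureTheory Filter Topology Set
open scoped ENNReal Classical

namespace Paper

variable {A : Type} [Fintype A] [DecidableEq A] [TopologicalSpace A] [DiscreteTopology A]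
  [MeasurableSpace A] [BorelSpace A]

/-- The left shift map on the full shift `A^ℕ`. -/
def shift : (ℕ → A) → (ℕ → A) := fun x i => x (i + 1)

/-- The cylinder set of a finite word `w`: points whose initial word is `w`. -/
def cylinder (w : List A) : Set (ℕ → A) := {x | ∀ i : Fin w.length, x i = w.get i}

/-- The language of `X`: finite words `w` with `[w] ∩ X ≠ ∅`. -/
def language (X : Set (ℕ → A)) : Set (List A) := {w | (cylinder w ∩ X).Nonempty}

/-- One edit of a word: a substitution, an insertion, or a deletion. -/
def EditStep (w w' : List A) : Prop :=
  (∃ u₁ u₂ : List A, ∃ a a' : A, w = u₁ ++ [a] ++ u₂ ∧ w' = u₁ ++ [a'] ++ u₂) ∨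
  (∃ u₁ u₂ : List A, ∃ a' : A, w = u₁ ++ u₂ ∧ w' = u₁ ++ [a'] ++ u₂) ∨
  (∃ u₁ u₂ : List A, ∃ a : A, w = u₁ ++ [a] ++ u₂ ∧ w' = u₁ ++ u₂)

/-- The edit distance: the minimal number of edits transforming `v` into `w`. -/
noncomputable def editDist (v w : List A) : ℕ :=
  sInf {n | ∃ f : ℕ → List A, f 0 = v ∧ f n = w ∧ ∀ i < n, EditStep (f i) (f (i + 1))}

/-- `G ⊆ L` has (W)-specification (with some gap length `τ`). -/
def HasSpecW (L G : Set (List A)) : Prop :=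
  ∃ τ : ℕ, ∀ v ∈ G, ∀ w ∈ G, ∃ u ∈ L, u.length ≤ τ ∧ v ++ u ++ w ∈ G

/-- A mistake function: nondecreasing with `g n / n → 0`. -/
def MistakeFun (g : ℕ → ℕ) : Prop :=
  Monotone g ∧ Tendsto (fun n => (g n : ℝ) / n) atTop (𝓝 0)

/-- `L` is edit approachable by `G`. -/
def EditApproachable (L G : Set (List A)) : Prop :=
  ∃ g : ℕ → ℕ, MistakeFun g ∧ ∀ w ∈ L, ∃ v ∈ G, editDist v w ≤ g w.length

/-- The shift map restricted to a (shift-invariant) subset `X`, as a self-map of `↥X`. -/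
noncomputable def subShift (X : Set (ℕ → A)) : ↥X → ↥X := fun x =>
  if h : shift x.val ∈ X then ⟨shift x.val, h⟩ else x

/-- Birkhoff sum `S_n φ = ∑_{i<n} φ ∘ σ^i`. -/
def birkhoff {Y : Type*} (σ : Y → Y) (φ : Y → ℝ) (n : ℕ) (y : Y) : ℝ :=
  ∑ i ∈ Finset.range n, φ (σ^[i] y)

/-- The Birkhoff average `(1/n) S_n φ`. -/
noncomputable def birkAvg {Y : Type*} (σ : Y → Y) (φ : Y → ℝ) (n : ℕ) (y : Y) : ℝ :=
  (n : ℝ)⁻¹ * birkhoff σ φ n y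

/-- Carathéodory sum `M(Z,t,φ,N)` over covers of `Z` by cylinders of length `> N`. -/
noncomputable def Mcal (X : Set (ℕ → A)) (φ : ↥X → ℝ) (Z : Set ↥X) (t : ℝ) (N : ℕ) : ℝ≥0∞ :=
  ⨅ (S : Set (List A)) (_ : S.Countable) (_ : ∀ w ∈ S, N < w.length)
    (_ : Z ⊆ ⋃ w ∈ S, Subtype.val ⁻¹' cylinder w),
    ∑' w : S, ENNReal.ofReal (Real.exp (-t * (w : List A).length +
      sSup (birkhoff (subShift X) φ (w : List A).length ''
        (Subtype.val ⁻¹' cylinder (w : List A)))))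

/-- `M(Z,t,φ) = lim_{N→∞} M(Z,t,φ,N)` (the limit of a nondecreasing quantity). -/
noncomputable def McalLim (X : Set (ℕ → A)) (φ : ↥X → ℝ) (Z : Set ↥X) (t : ℝ) : ℝ≥0∞ :=
  ⨆ N : ℕ, Mcal X φ Z t N

/-- The topological pressure `P_Z(φ)` of `Z ⊆ X`. -/
noncomputable def pressure (X : Set (ℕ → A)) (φ : ↥X → ℝ) (Z : Set ↥X) : ℝ :=
  sInf {t : ℝ | McalLim X φ Z t = 0}

/-- The empirical measure `ℰ_n(x) = (1/n) ∑_{i<n} δ_{σ^i x}`. -/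
noncomputable def empiric {Y : Type*} [MeasurableSpace Y] (σ : Y → Y) (n : ℕ) (x : Y) :
    Measure Y := (n : ℝ≥0∞)⁻¹ • ∑ i ∈ Finset.range n, Measure.dirac (σ^[i] x)

/-- The set `A(ℰ_n(x))` of weak* limit points of the sequence of empirical measures of `x`:
probability measures that are limits of the empirical measures along a subsequence. -/
def limitPts {Y : Type*} [MeasurableSpace Y] [TopologicalSpace Y] (σ : Y → Y) (x : Y) :
    Set (ProbabilityMeasure Y) :=
  {μ | ∃ φ : ℕ → ℕ, StrictMono φ ∧ ∀ f : C(Y, ℝ),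
      Tendsto (fun k => birkAvg σ (fun y => f y) (φ k) x) atTop (𝓝 (∫ y, f y ∂μ.toMeasure))}

/-- The saturated set `G_K = {x : A(ℰ_n(x)) = K}`. -/
def saturated {Y : Type*} [MeasurableSpace Y] [TopologicalSpace Y] (σ : Y → Y)
    (K : Set (ProbabilityMeasure Y)) : Set Y := {x | limitPts σ x = K}

/-- The generic points of `μ`: those `x` with `ℰ_n(x) → μ` in the weak* topology. -/
def genericPts {Y : Type*} [MeasurableSpace Y] [TopologicalSpace Y] (σ : Y → Y)
    (μ : ProbabilityMeasure Y) : Set Y :=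
  {x | ∀ f : C(Y, ℝ),
      Tendsto (fun n => birkAvg σ (fun y => f y) n x) atTop (𝓝 (∫ y, f y ∂μ.toMeasure))}

/-- `μ` is a `σ`-invariant (probability) measure. -/
def IsInvariant {Y : Type*} [MeasurableSpace Y] (σ : Y → Y) (μ : ProbabilityMeasure Y) : Prop :=
  μ.toMeasure.map σ = μ.toMeasure

/-- The level set `X(ψ,α)` of points whose Birkhoff averages of `ψ` converge to `α`. -/
def levelSet {Y : Type*} (σ : Y → Y) (ψ : Y → ℝ) (α : ℝ) : Set Y :=
  {x | Tendsto (fun n => birkAvg σ ψ n x) atTop (𝓝 α)}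

/-- The irregular set `X̂(ψ)` of points whose Birkhoff averages of `ψ` do not converge. -/
def irregular {Y : Type*} (σ : Y → Y) (ψ : Y → ℝ) : Set Y :=
  {x | ¬ ∃ α : ℝ, Tendsto (fun n => birkAvg σ ψ n x) atTop (𝓝 α)}

/-- The cylinder of a word of length `n` given as `w : Fin n → A`. -/
def cylF {n : ℕ} (w : Fin n → A) : Set (ℕ → A) := {x | ∀ i : Fin n, x i = w i}

/-- The entropy `H_n(μ)` of the partition of `X` into cylinders of length `n`. -/
noncomputable def wordEntropy (X : Set (ℕ → A)) (μ : ProbabilityMeasure ↥X) (n : ℕ) : ℝ :=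
  ∑ w : Fin n → A, Real.negMulLog ((μ.toMeasure (Subtype.val ⁻¹' cylF w)).toReal)

/-- The measure-theoretic (Kolmogorov–Sinai) entropy `h_μ(σ)` of a shift-invariant measure on a
subshift: by subadditivity, `lim_n H_n/n = inf_{n ≥ 1} H_n/n`. -/
noncomputable def entropy (X : Set (ℕ → A)) (μ : ProbabilityMeasure ↥X) : ℝ :=
  ⨅ n : ℕ, wordEntropy X μ (n + 1) / (n + 1)

/-- The distance `D` on measures induced by a countable family of continuous functions. -/
noncomputable def Dmetric {Y : Type*} [MeasurableSpace Y] [TopologicalSpace Y]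
    (f : ℕ → C(Y, ℝ)) (μ ν : Measure Y) : ℝ :=
  ∑' k : ℕ, ((2 : ℝ) ^ (k + 1))⁻¹ * |(∫ y, f k y ∂μ) - ∫ y, f k y ∂ν|

/-- The family `f` is separating: `D` separates Borel probability measures. -/
def Separating {Y : Type*} [MeasurableSpace Y] [TopologicalSpace Y] (f : ℕ → C(Y, ℝ)) : Prop :=
  ∀ μ ν : ProbabilityMeasure Y,
    (∀ k, (∫ y, f k y ∂μ.toMeasure) = ∫ y, f k y ∂ν.toMeasure) → μ = ν

/-- Diameter of a set with respect to a distance function `d`, valued in `ℝ≥0∞`. -/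
noncomputable def ediam {Y : Type*} (d : Y → Y → ℝ) (U : Set Y) : ℝ≥0∞ :=
  ⨆ x ∈ U, ⨆ y ∈ U, ENNReal.ofReal (d x y)

/-- The `s`-dimensional Hausdorff pre-measure at scale `ε` w.r.t. the distance `d`. -/
noncomputable def hMeasAux {Y : Type*} (d : Y → Y → ℝ) (s : ℝ) (ε : ℝ≥0∞) (Z : Set Y) : ℝ≥0∞ :=
  ⨅ (C : ℕ → Set Y) (_ : Z ⊆ ⋃ n, C n) (_ : ∀ n, ediam d (C n) ≤ ε),
    ∑' n, ⨆ (_ : (C n).Nonempty), ediam d (C n) ^ s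

/-- The `s`-dimensional Hausdorff measure w.r.t. the distance `d`. -/
noncomputable def hMeas {Y : Type*} (d : Y → Y → ℝ) (s : ℝ) (Z : Set Y) : ℝ≥0∞ :=
  ⨆ (ε : ℝ≥0∞) (_ : 0 < ε), hMeasAux d s ε Z

/-- The Hausdorff dimension of `Z` w.r.t. the distance `d`. -/
noncomputable def hdim {Y : Type*} (d : Y → Y → ℝ) (Z : Set Y) : ℝ :=
  sInf {s : ℝ | 0 ≤ s ∧ hMeas d s Z = 0}

/-- The length `|x ∧ y|` of the longest common prefix of two distinct points. -/
noncomputable def wedge (x y : ℕ → A) : ℕ := sInf {n | x n ≠ y n}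

/-- The Gatzouras–Peres distance `d_φ` associated with a strictly positive continuous `φ`. -/
noncomputable def dphi (X : Set (ℕ → A)) (φ : ↥X → ℝ) (x y : ↥X) : ℝ :=
  if x = y then 0
  else Real.exp (-(sSup (birkhoff (subShift X) φ (wedge x.val y.val) ''
      {z : ↥X | ∀ i < wedge x.val y.val, z.val i = x.val i})))

/-- The word `w` occurs in `x` at position `k`. -/
def occursAt (w : List A) (x : ℕ → A) (k : ℕ) : Prop :=
  ∀ i : Fin w.length, x (k + i) = w.get i

/-- A shift of finite type: determined by a finite set of forbidden words. -/
def IsSFT {B : Type} (Z : Set (ℕ → B)) : Prop :=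
  ∃ F : Set (List B), F.Finite ∧ Z = {x | ∀ w ∈ F, ∀ k, ¬ occursAt w x k}

/-- A sofic shift: the image of a shift of finite type under a sliding block code. -/
def IsSofic (Y : Set (ℕ → A)) : Prop :=
  ∃ (B : Type) (_ : Fintype B) (Z : Set (ℕ → B)) (π : (ℕ → B) → (ℕ → A)),
    IsSFT Z ∧ Set.MapsTo shift Z Z ∧
    (∃ r : ℕ, ∀ z ∈ Z, ∀ z' ∈ Z, ∀ k, (∀ i ≤ k + r, z i = z' i) → π z k = π z' k) ∧
    (∀ z ∈ Z, π (shift z) = shift (π z)) ∧ π '' Z = Y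

/-- Topological transitivity of a subshift, via its language. -/
def IsTransitive (Y : Set (ℕ → A)) : Prop :=
  ∀ u ∈ language Y, ∀ v ∈ language Y, ∃ w : List A, u ++ w ++ v ∈ language Y

/-- The prefix of length `n` of `x`, as a word. -/
def prefixWord (x : ℕ → A) (n : ℕ) : List A := List.ofFn fun i : Fin n => x i

/-- The norm `‖m‖ = sup_{0 < ‖f‖ ≤ 1} |∫ f dm| / ‖f‖` of a measure on a compact space. -/
noncomputable def mnorm {Y : Type*} [TopologicalSpace Y] [CompactSpace Y] [MeasurableSpace Y]
    (m : Measure Y) : ℝ :=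
  sSup ((fun f : C(Y, ℝ) => |∫ y, f y ∂m| / ‖f‖) '' {f : C(Y, ℝ) | 0 < ‖f‖ ∧ ‖f‖ ≤ 1})

/-- Strict lexicographic order on `ℕ`-indexed sequences of naturals. -/
def lexLt (x y : ℕ → ℕ) : Prop := ∃ n : ℕ, (∀ i < n, x i = y i) ∧ x n < y n

/-- The β-shift: all sequences over `{0, …, b-1}` all of whose shifts are lexicographically
below the expansion `w` of `1` in base `β` (where `b = ⌈β⌉`). -/
def betaShift (b : ℕ) (w : ℕ → ℕ) : Set (ℕ → Fin b) :=
  {x | ∀ j : ℕ, 1 ≤ j → lexLt (fun i => ((shift^[j] x) i : ℕ)) w}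

/-- The S-gap shift: sequences over `{0,1}` such that the number of `0`s between any two
consecutive `1`s lies in `S`. -/
def sGapShift (S : Set ℕ) : Set (ℕ → Fin 2) :=
  {x | ∀ k l : ℕ, k < l → x k = 1 → x l = 1 →
    (∀ m : ℕ, k < m → m < l → x m = 0) → l - k - 1 ∈ S}

set_option linter.unusedSectionVars false

/-! ### Words, prefixes and the shift -/

lemma length_prefixWord (x : ℕ → A) (n : ℕ) : (prefixWord x n).length = n := by
  simp [prefixWord]

lemma prefixWord_zero (x : ℕ → A) : prefixWord x 0 = [] := by
  simp [prefixWord]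

lemma prefixWord_succ (x : ℕ → A) (n : ℕ) :
    prefixWord x (n + 1) = x 0 :: prefixWord (shift x) n := by
  simp [prefixWord, shift, List.ofFn_succ]

lemma prefixWord_eq_iff {x y : ℕ → A} {n : ℕ} :
    prefixWord x n = prefixWord y n ↔ ∀ i < n, x i = y i := by
  simp only [prefixWord, List.ofFn_inj, funext_iff]
  exact ⟨fun h i hi => h ⟨i, hi⟩, fun h i => h i i.2⟩

lemma shift_iterate_apply (x : ℕ → A) (m i : ℕ) : (shift^[m] x) i = x (i + m) := by
  induction m generalizing x with
  | zero => rfl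
  | succ m ih => rw [Function.iterate_succ_apply, ih]; simp [shift, add_assoc]

lemma prefixWord_add (x : ℕ → A) (m n : ℕ) :
    prefixWord x (m + n) = prefixWord x m ++ prefixWord (shift^[m] x) n := by
  induction m generalizing x with
  | zero => simp [prefixWord_zero]
  | succ m ih =>
    rw [Nat.succ_add_eq_add_succ, Nat.add_succ, prefixWord_succ, ih, prefixWord_succ]
    rfl

lemma take_prefixWord (x : ℕ → A) {m n : ℕ} (h : m ≤ n) :
    (prefixWord x n).take m = prefixWord x m := by
  obtain ⟨k, rfl⟩ := Nat.exists_eq_add_of_le h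
  rw [prefixWord_add, List.take_left' (length_prefixWord _ _)]

lemma mem_cylinder_iff {w : List A} {x : ℕ → A} :
    x ∈ cylinder w ↔ prefixWord x w.length = w := by
  constructor
  · intro h
    apply List.ext_get
    · simp [length_prefixWord]
    · intro n h1 h2
      simpa [prefixWord] using h ⟨n, h2⟩
  · intro h i
    have h1 : (prefixWord x w.length).get ⟨i, by simp [length_prefixWord]⟩ = x i := by
      simp [prefixWord]
    rw [← h1]
    simp only [List.get_eq_getElem]
    congr 1

lemma mem_language_iff {X : Set (ℕ → A)} {w : List A} :
    w ∈ language X ↔ ∃ x : X, prefixWord x.1 w.length = w := by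
  constructor
  · rintro ⟨x, hx, hX⟩
    exact ⟨⟨x, hX⟩, mem_cylinder_iff.1 hx⟩
  · rintro ⟨x, hx⟩
    exact ⟨x.1, mem_cylinder_iff.2 hx, x.2⟩

section Shift

variable {X : Set (ℕ → A)}

lemma subShift_val (hX : Set.MapsTo shift X X) (x : X) : (subShift X x).1 = shift x.1 := by
  simp [subShift, dif_pos (hX x.2)]

lemma subShift_iterate_val (hX : Set.MapsTo shift X X) (x : X) (n : ℕ) :
    ((subShift X)^[n] x).1 = shift^[n] x.1 := by
  induction n generalizing x with
  | zero => rfl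
  | succ n ih => rw [Function.iterate_succ_apply, ih, subShift_val hX, Function.iterate_succ_apply]

lemma continuous_shift : Continuous (shift : (ℕ → A) → (ℕ → A)) :=
  continuous_pi fun i => continuous_apply (i + 1)

lemma continuous_subShift (hX : Set.MapsTo shift X X) : Continuous (subShift X) := by
  refine continuous_induced_rng.2 ?_
  have : Subtype.val ∘ subShift X = shift ∘ (Subtype.val : X → ℕ → A) :=
    funext fun x => subShift_val hX x
  rw [this]
  exact continuous_shift.comp continuous_subtype_val

end Shift

/-! ### Birkhoff sums -/

section Birkhoff

variable {Y : Type*} (σ : Y → Y) (f : Y → ℝ)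

lemma birkhoff_zero (y : Y) : birkhoff σ f 0 y = 0 := by simp [birkhoff]

lemma birkhoff_succ (n : ℕ) (y : Y) : birkhoff σ f (n + 1) y = f y + birkhoff σ f n (σ y) := by
  simp only [birkhoff, Finset.sum_range_succ', Function.iterate_succ_apply]
  simp [add_comm]

lemma birkhoff_add (m n : ℕ) (y : Y) :
    birkhoff σ f (m + n) y = birkhoff σ f m y + birkhoff σ f n (σ^[m] y) := by
  simp only [birkhoff, Finset.sum_range_add]
  congr 1
  refine Finset.sum_congr rfl fun i _ => ?_
  rw [← Function.iterate_add_apply, add_comm]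

lemma abs_birkhoff_le {M : ℝ} (hM : ∀ y, |f y| ≤ M) (n : ℕ) (y : Y) :
    |birkhoff σ f n y| ≤ n * M := by
  refine (Finset.abs_sum_le_sum_abs _ _).trans ?_
  refine (Finset.sum_le_card_nsmul _ _ M fun i _ => hM _).trans ?_
  simp

lemma le_birkhoff {c : ℝ} (hc : ∀ y, c ≤ f y) (n : ℕ) (y : Y) : n * c ≤ birkhoff σ f n y := by
  have := Finset.card_nsmul_le_sum (Finset.range n) (fun i => f (σ^[i] y)) c fun i _ => hc _
  simpa [birkhoff] using this

lemma birkhoff_sub_const (a : ℝ) (n : ℕ) (y : Y) :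
    birkhoff σ (fun z => f z - a) n y = birkhoff σ f n y - n * a := by
  simp [birkhoff]

end Birkhoff

/-! ### Approximation of Birkhoff sums by almost additive functions of words -/

/-- On a compact subshift, the value of a continuous function is determined up to `δ` by a prefix
of bounded length. -/
lemma exists_prefix_modulus {X : Set (ℕ → A)} (hXcl : IsClosed X) {f : X → ℝ} (hf : Continuous f)
    {δ : ℝ} (hδ : 0 < δ) :
    ∃ r : ℕ, ∀ x y : X, prefixWord x.1 r = prefixWord y.1 r → |f x - f y| ≤ δ := by
  have : CompactSpace X := isCompact_iff_compactSpace.1 hXcl.isCompact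
  have key : ∀ x : X, ∃ n : ℕ, ∀ y : X, y.1 ∈ PiNat.cylinder x.1 n → |f y - f x| < δ / 2 := by
    intro x
    have hU : f ⁻¹' Metric.ball (f x) (δ / 2) ∈ 𝓝 x :=
      hf.continuousAt (Metric.ball_mem_nhds _ (by positivity))
    rw [mem_nhds_induced] at hU
    obtain ⟨u, hu, hsub⟩ := hU
    obtain ⟨v, hv, hxv, hvu⟩ := (PiNat.isTopologicalBasis_cylinders (fun _ : ℕ => A)).mem_nhds_iff.1 hu
    obtain ⟨z, n, rfl⟩ := hv
    refine ⟨n, fun y hy => ?_⟩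
    have : y.1 ∈ PiNat.cylinder z n := by
      rw [PiNat.mem_cylinder_iff_eq.1 hxv] at hy
      exact hy
    have := hsub (hvu this)
    simpa [Real.dist_eq] using this
  choose N hN using key
  obtain ⟨t, ht⟩ := isCompact_univ.elim_nhds_subcover
    (fun x : X => Subtype.val ⁻¹' PiNat.cylinder x.1 (N x)) (fun x _ =>
      ((PiNat.isOpen_cylinder _ x.1 (N x)).preimage continuous_subtype_val).mem_nhds
        (PiNat.self_mem_cylinder _ _))
  refine ⟨t.sup N, fun x y hxy => ?_⟩
  obtain ⟨z, hz, hxz⟩ := mem_iUnion₂.1 (ht.2 (mem_univ x))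
  have hyz : y.1 ∈ PiNat.cylinder z.1 (N z) := by
    intro i hi
    rw [← hxz i hi]
    exact (prefixWord_eq_iff.1 hxy i (hi.trans_le (Finset.le_sup hz))).symm
  have h1 := hN z x hxz
  have h2 := hN z y hyz
  rw [abs_lt] at h1 h2
  rw [abs_le]
  constructor <;> linarith

lemma exists_abs_le {X : Set (ℕ → A)} (hXcl : IsClosed X) {f : X → ℝ} (hf : Continuous f) :
    ∃ M : ℝ, 0 ≤ M ∧ ∀ x, |f x| ≤ M := by
  have : CompactSpace X := isCompact_iff_compactSpace.1 hXcl.isCompact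
  obtain ⟨M, hM⟩ := isCompact_univ.exists_bound_of_continuousOn hf.continuousOn
  exact ⟨max M 0, le_max_right _ _, fun x => (hM x (mem_univ x)).trans (le_max_left _ _)⟩

/-- `B` is almost additive on words, with defect at most `C`. -/
structure AlmostAdditive (B : List A → ℝ) (C : ℝ) : Prop where
  nonneg : 0 ≤ C
  append : ∀ u v, |B (u ++ v) - B u - B v| ≤ C
  singleton : ∀ a, |B [a]| ≤ C

lemma AlmostAdditive.mono {B : List A → ℝ} {C C' : ℝ} (h : AlmostAdditive B C) (hC : C ≤ C') :
    AlmostAdditive B C' :=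
  ⟨h.nonneg.trans hC, fun u v => (h.append u v).trans hC, fun a => (h.singleton a).trans hC⟩

/-- The sum of the values of `F` on all suffixes of a word. -/
def suffixSum (F : List A → ℝ) : List A → ℝ
  | [] => 0
  | a :: w => F (a :: w) + suffixSum F w

lemma suffixSum_append {F : List A → ℝ} {M : ℝ} {r : ℕ} (hM : ∀ w, |F w| ≤ M)
    (hF : ∀ u v : List A, r ≤ u.length → F (u ++ v) = F u) (u v : List A) :
    |suffixSum F (u ++ v) - suffixSum F u - suffixSum F v| ≤ 2 * M * (min u.length r : ℕ) := by
  induction u with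
  | nil => simp [suffixSum]
  | cons a u ih =>
    have e : suffixSum F (a :: u ++ v) - suffixSum F (a :: u) - suffixSum F v
        = (F ((a :: u) ++ v) - F (a :: u)) + (suffixSum F (u ++ v) - suffixSum F u - suffixSum F v) := by
      simp only [List.cons_append, suffixSum]; ring
    rw [e]
    rcases le_or_gt r (a :: u).length with h | h
    · rw [hF _ _ h, sub_self, zero_add]
      refine ih.trans ?_
      have hM0 : 0 ≤ M := (abs_nonneg _).trans (hM [])
      have : min u.length r ≤ min (a :: u).length r := by
        simp
      gcongr
    · have h1 : min u.length r = u.length := by simp at h; omega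
      have h2 : min (a :: u).length r = u.length + 1 := by simp at h ⊢; omega
      rw [h1] at ih
      rw [h2]
      push_cast
      have h3 := hM ((a :: u) ++ v)
      have h4 := hM (a :: u)
      rw [abs_le] at *
      constructor <;> linarith

/-- Birkhoff sums of a continuous function are, up to a small linear error, given by an almost
additive function of words. -/
lemma exists_almostAdditive {X : Set (ℕ → A)} (hXcl : IsClosed X) (hXinv : Set.MapsTo shift X X)
    {f : X → ℝ} (hf : Continuous f) {δ : ℝ} (hδ : 0 < δ) :
    ∃ (B : List A → ℝ) (C : ℝ), AlmostAdditive B C ∧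
      ∀ (x : X) (n : ℕ), |birkhoff (subShift X) f n x - B (prefixWord x.1 n)| ≤ δ * n + C := by
  obtain ⟨r, hr⟩ := exists_prefix_modulus hXcl hf hδ
  obtain ⟨M, hM0, hM⟩ := exists_abs_le hXcl hf
  let F : List A → ℝ := fun v =>
    if h : ∃ x : X, prefixWord x.1 r = v.take r then f h.choose else 0
  have hFM : ∀ w, |F w| ≤ M := by
    intro w
    by_cases h : ∃ x : X, prefixWord x.1 r = w.take r
    · simp only [F, dif_pos h]; exact hM _
    · simp only [F, dif_neg h]; simpa using hM0
  have hF : ∀ u v : List A, r ≤ u.length → F (u ++ v) = F u := by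
    intro u v h
    simp only [F, List.take_append_of_le_length h]
  have hFx : ∀ (x : X) n, r ≤ n → |f x - F (prefixWord x.1 n)| ≤ δ := by
    intro x n hn
    have h : ∃ y : X, prefixWord y.1 r = (prefixWord x.1 n).take r := ⟨x, (take_prefixWord _ hn).symm⟩
    simp only [F, dif_pos h]
    apply hr
    rw [h.choose_spec, take_prefixWord _ hn]
  refine ⟨suffixSum F, 2 * M * r + M, ⟨by positivity, fun u v => ?_, fun a => ?_⟩, ?_⟩
  · refine (suffixSum_append hFM hF u v).trans ?_
    have : ((min u.length r : ℕ) : ℝ) ≤ r := by exact_mod_cast min_le_right _ _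
    nlinarith
  · simp only [suffixSum, add_zero]
    refine (hFM _).trans ?_
    have : 0 ≤ 2 * M * r := by positivity
    linarith
  · have key : ∀ (n : ℕ) (x : X),
        |birkhoff (subShift X) f n x - suffixSum F (prefixWord x.1 n)|
          ≤ δ * n + 2 * M * (min n r : ℕ) := by
      intro n
      induction n with
      | zero => intro x; simp [birkhoff_zero, prefixWord_zero, suffixSum]
      | succ n ih =>
        intro x
        have ih := ih (subShift X x)
        rw [subShift_val hXinv] at ih
        have e : birkhoff (subShift X) f (n + 1) x - suffixSum F (prefixWord x.1 (n + 1))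
            = (f x - F (prefixWord x.1 (n + 1))) + (birkhoff (subShift X) f n (subShift X x) -
              suffixSum F (prefixWord (shift x.1) n)) := by
          rw [birkhoff_succ, prefixWord_succ, suffixSum]; ring
        rw [e]
        rcases le_or_gt r (n + 1) with h | h
        · have h1 := hFx x (n + 1) h
          have h2 : ((min n r : ℕ) : ℝ) ≤ (min (n + 1) r : ℕ) := by
            exact_mod_cast (by omega : min n r ≤ min (n + 1) r)
          have h3 : 2 * M * ((min n r : ℕ) : ℝ) ≤ 2 * M * (min (n + 1) r : ℕ) := by gcongr
          refine (abs_add_le _ _).trans ?_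
          push_cast at *
          linarith
        · have h1 : min n r = n := by omega
          have h2 : min (n + 1) r = n + 1 := by omega
          rw [h1] at ih
          rw [h2]
          have h3 := hM x
          have h4 := hFM (prefixWord x.1 (n + 1))
          have h5 := abs_sub (f x) (F (prefixWord x.1 (n + 1)))
          refine (abs_add_le _ _).trans ?_
          push_cast at *
          linarith
    intro x n
    refine (key n x).trans ?_
    have : ((min n r : ℕ) : ℝ) ≤ r := by exact_mod_cast min_le_right _ _
    nlinarith

/-- Birkhoff sums along two points with a common prefix are close. -/
lemma exists_birkhoff_sub_le {X : Set (ℕ → A)} (hXcl : IsClosed X) (hXinv : Set.MapsTo shift X X)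
    {f : X → ℝ} (hf : Continuous f) {δ : ℝ} (hδ : 0 < δ) :
    ∃ C : ℝ, 0 ≤ C ∧ ∀ (x y : X) (n : ℕ), prefixWord x.1 n = prefixWord y.1 n →
      |birkhoff (subShift X) f n x - birkhoff (subShift X) f n y| ≤ δ * n + C := by
  obtain ⟨B, C, hB, h⟩ := exists_almostAdditive hXcl hXinv hf (half_pos hδ)
  refine ⟨2 * C, by have := hB.nonneg; linarith, fun x y n hxy => ?_⟩
  have h1 := h x n
  have h2 := h y n
  rw [hxy] at h1
  rw [abs_le] at *
  constructor <;> linarith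

/-! ### Hausdorff measures -/

section Hausdorff

variable {Y : Type*} (d : Y → Y → ℝ)

lemma le_ediam {U : Set Y} {x y : Y} (hx : x ∈ U) (hy : y ∈ U) :
    ENNReal.ofReal (d x y) ≤ ediam d U :=
  le_iSup₂_of_le x hx (le_iSup₂_of_le y hy le_rfl)

lemma ediam_le {U : Set Y} {c : ℝ≥0∞} (h : ∀ x ∈ U, ∀ y ∈ U, ENNReal.ofReal (d x y) ≤ c) :
    ediam d U ≤ c :=
  iSup₂_le fun x hx => iSup₂_le fun y hy => h x hx y hy

lemma hMeasAux_le_tsum {ι : Type*} [Countable ι] (s : ℝ) (ε : ℝ≥0∞) {Z : Set Y} (C : ι → Set Y)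
    (hZ : Z ⊆ ⋃ i, C i) (hC : ∀ i, ediam d (C i) ≤ ε) :
    hMeasAux d s ε Z ≤ ∑' i, ⨆ (_ : (C i).Nonempty), ediam d (C i) ^ s := by
  obtain ⟨_⟩ := nonempty_encodable ι
  have h := tsum_iSup_decode₂ (fun U : Set Y => ⨆ (_ : U.Nonempty), ediam d U ^ s) (by simp) C
  rw [← h]
  refine iInf_le_of_le (fun n => ⨆ b ∈ Encodable.decode₂ ι n, C b) ?_
  refine iInf_le_of_le ?_ (iInf_le_of_le ?_ le_rfl)
  · refine hZ.trans (le_of_eq ?_)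
    exact (Encodable.iUnion_decode₂ C).symm
  · intro n
    refine ediam_le d fun x hx y hy => ?_
    simp only [iSup_eq_iUnion, mem_iUnion] at hx hy
    obtain ⟨i, hi, hxi⟩ := hx
    obtain ⟨j, hj, hyj⟩ := hy
    obtain rfl : i = j := by
      rw [Option.mem_def] at hi hj
      simpa [hi] using hj
    exact (le_ediam d hxi hyj).trans (hC i)

lemma exists_cover_of_hMeasAux_lt {s : ℝ} {ε c : ℝ≥0∞} {Z : Set Y} (h : hMeasAux d s ε Z < c) :
    ∃ C : ℕ → Set Y, Z ⊆ ⋃ n, C n ∧ (∀ n, ediam d (C n) ≤ ε) ∧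
      ∑' n, (⨆ (_ : (C n).Nonempty), ediam d (C n) ^ s) < c := by
  simp only [hMeasAux, iInf_lt_iff] at h
  obtain ⟨C, h1, h2, h3⟩ := h
  exact ⟨C, h1, h2, h3⟩

lemma hMeasAux_mono {s : ℝ} {ε : ℝ≥0∞} {Z Z' : Set Y} (h : Z ⊆ Z') :
    hMeasAux d s ε Z ≤ hMeasAux d s ε Z' :=
  le_iInf fun C => le_iInf fun h1 => le_iInf fun h2 =>
    iInf_le_of_le C (iInf_le_of_le (h.trans h1) (iInf_le_of_le h2 le_rfl))

lemma hMeasAux_iUnion_eq_zero {ι : Type*} [Countable ι] {s : ℝ} {ε : ℝ≥0∞} {Z : ι → Set Y}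
    (h : ∀ i, hMeasAux d s ε (Z i) = 0) : hMeasAux d s ε (⋃ i, Z i) = 0 := by
  refine le_antisymm (ENNReal.le_of_forall_pos_le_add fun η hη _ => ?_) bot_le
  obtain ⟨η', hη', hsum⟩ := ENNReal.exists_pos_sum_of_countable
    (ENNReal.coe_pos.2 hη).ne' ι
  have : ∀ i, ∃ C : ℕ → Set Y, Z i ⊆ ⋃ n, C n ∧ (∀ n, ediam d (C n) ≤ ε) ∧
      ∑' n, (⨆ (_ : (C n).Nonempty), ediam d (C n) ^ s) < η' i := fun i =>
    exists_cover_of_hMeasAux_lt d (by rw [h i]; exact_mod_cast hη' i)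
  choose C h1 h2 h3 using this
  refine (hMeasAux_le_tsum d s ε (fun p : ι × ℕ => C p.1 p.2) ?_ fun p => h2 _ _).trans ?_
  · refine iUnion_subset fun i x hx => ?_
    obtain ⟨n, hn⟩ := mem_iUnion.1 (h1 i hx)
    exact mem_iUnion.2 ⟨(i, n), hn⟩
  · rw [ENNReal.tsum_prod (f := fun i n => ⨆ (_ : (C i n).Nonempty), ediam d (C i n) ^ s), zero_add]
    exact (ENNReal.tsum_le_tsum fun i => (h3 i).le).trans hsum.le

lemma hMeas_eq_zero_iff {s : ℝ} {Z : Set Y} :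
    hMeas d s Z = 0 ↔ ∀ ε : ℝ≥0∞, 0 < ε → hMeasAux d s ε Z = 0 := by
  simp [hMeas]

lemma hdim_le {s : ℝ} (hs : 0 ≤ s) {Z : Set Y} (h : hMeas d s Z = 0) : hdim d Z ≤ s :=
  csInf_le ⟨0, fun _ hx => hx.1⟩ ⟨hs, h⟩

lemma hdim_nonneg {Z : Set Y} : 0 ≤ hdim d Z := Real.sInf_nonneg fun _ hx => hx.1

end Hausdorff

/-! ### The metric `dphi` -/

section Dphi

variable {X : Set (ℕ → A)}

lemma prefixWord_wedge {x y : ℕ → A} : prefixWord x (wedge x y) = prefixWord y (wedge x y) := by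
  rw [prefixWord_eq_iff]
  intro i hi
  by_contra h
  exact (Nat.sInf_le (show i ∈ {n | x n ≠ y n} from h)).not_gt hi

lemma apply_wedge_ne {x y : ℕ → A} (h : x ≠ y) : x (wedge x y) ≠ y (wedge x y) := by
  have : {n | x n ≠ y n}.Nonempty := by
    by_contra hn
    rw [Set.not_nonempty_iff_eq_empty, Set.eq_empty_iff_forall_notMem] at hn
    exact h (funext fun n => by simpa using hn n)
  exact Nat.sInf_mem this

lemma le_wedge {x y : ℕ → A} (h : x ≠ y) {n : ℕ} (hn : prefixWord x n = prefixWord y n) :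
    n ≤ wedge x y := by
  by_contra hlt
  exact apply_wedge_ne h (prefixWord_eq_iff.1 hn _ (not_le.1 hlt))

lemma setOf_agree (x : X) (n : ℕ) :
    {z : X | ∀ i < n, z.1 i = x.1 i} = {z : X | prefixWord z.1 n = prefixWord x.1 n} := by
  ext z; simp only [mem_ofPred_eq, prefixWord_eq_iff]

lemma bddAbove_birkhoff_image (hXcl : IsClosed X) {φ : X → ℝ} (hφ : Continuous φ) (n : ℕ)
    (U : Set X) : BddAbove (birkhoff (subShift X) φ n '' U) := by
  obtain ⟨M, -, hM⟩ := exists_abs_le hXcl hφ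
  refine ⟨n * M, ?_⟩
  rintro _ ⟨z, -, rfl⟩
  exact (abs_le.1 (abs_birkhoff_le _ _ hM n z)).2

/-- Lower bound for the metric in terms of Birkhoff sums. -/
lemma exp_neg_le_dphi {φ : X → ℝ} {x y : X} (hxy : x ≠ y) {c : ℝ}
    (h : ∀ z : X, prefixWord z.1 (wedge x.1 y.1) = prefixWord x.1 (wedge x.1 y.1) →
      birkhoff (subShift X) φ (wedge x.1 y.1) z ≤ c) :
    Real.exp (-c) ≤ dphi X φ x y := by
  rw [dphi, if_neg hxy, setOf_agree, Real.exp_le_exp, neg_le_neg_iff]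
  refine csSup_le ⟨_, x, rfl, rfl⟩ ?_
  rintro _ ⟨z, hz, rfl⟩
  exact h z hz

lemma dphi_le (hXcl : IsClosed X) {φ : X → ℝ} (hφ : Continuous φ) {x y : X} (hxy : x ≠ y) :
    dphi X φ x y ≤ Real.exp (-birkhoff (subShift X) φ (wedge x.1 y.1) x) := by
  rw [dphi, if_neg hxy, setOf_agree, Real.exp_le_exp, neg_le_neg_iff]
  exact le_csSup (bddAbove_birkhoff_image hXcl hφ _ _) ⟨x, rfl, rfl⟩

lemma birkhoff_mono_of_nonneg {φ : X → ℝ} (hφ : ∀ x, 0 ≤ φ x) {m n : ℕ} (h : m ≤ n) (x : X) :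
    birkhoff (subShift X) φ m x ≤ birkhoff (subShift X) φ n x :=
  Finset.sum_le_sum_of_subset_of_nonneg (by simpa using h) fun _ _ _ => hφ _

/-- The diameter of a cylinder is controlled by Birkhoff sums along any of its points. -/
lemma exists_ediam_cylinder_le (hXcl : IsClosed X) (hXinv : Set.MapsTo shift X X)
    {φ : X → ℝ} (hφ : Continuous φ) (hφpos : ∀ x, 0 < φ x) {δ : ℝ} (hδ : 0 < δ) :
    ∃ C : ℝ, 0 ≤ C ∧ ∀ (x : X) (n : ℕ),
      ediam (dphi X φ) {z : X | prefixWord z.1 n = prefixWord x.1 n} ≤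
        ENNReal.ofReal (Real.exp (-birkhoff (subShift X) φ n x + δ * n + C)) := by
  obtain ⟨C, hC, h⟩ := exists_birkhoff_sub_le hXcl hXinv hφ hδ
  refine ⟨C, hC, fun x n => ediam_le _ fun y hy z hz => ENNReal.ofReal_le_ofReal ?_⟩
  by_cases hyz : y = z
  · rw [dphi, if_pos hyz]; positivity
  · refine (dphi_le hXcl hφ hyz).trans (Real.exp_le_exp.2 ?_)
    have h1 : n ≤ wedge y.1 z.1 := le_wedge (fun h => hyz (Subtype.ext h)) (hy.trans hz.symm)
    have h2 := birkhoff_mono_of_nonneg (fun x => (hφpos x).le) h1 y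
    have h3 := abs_le.1 (h y x n hy)
    linarith [h3.1]

end Dphi

/-! ### Conditional entropy of cylinders -/

section CondEntropy

variable {X : Set (ℕ → A)}

/-- The restriction of a sequence to its first `n` coordinates. -/
def initial (n : ℕ) (x : ℕ → A) : Fin n → A := fun i => x i

lemma mem_cylF_iff {n : ℕ} {w : Fin n → A} {x : ℕ → A} : x ∈ cylF w ↔ initial n x = w :=
  funext_iff.symm

lemma initial_eq_iff {n : ℕ} {x y : ℕ → A} : initial n x = initial n y ↔ ∀ i < n, x i = y i :=
  ⟨fun h i hi => congrFun h ⟨i, hi⟩, fun h => funext fun i => h i i.2⟩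

lemma continuous_initial (n : ℕ) : Continuous fun x : X => initial n x.1 :=
  continuous_pi fun _ => (continuous_apply _).comp continuous_subtype_val

/-- The measure of a cylinder. -/
noncomputable def cylMass (μ : ProbabilityMeasure X) {n : ℕ} (w : Fin n → A) : ℝ :=
  μ.toMeasure.real (Subtype.val ⁻¹' cylF w)

lemma cylMass_nonneg (μ : ProbabilityMeasure X) {n : ℕ} (w : Fin n → A) : 0 ≤ cylMass μ w :=
  measureReal_nonneg

lemma cylMass_le_one (μ : ProbabilityMeasure X) {n : ℕ} (w : Fin n → A) : cylMass μ w ≤ 1 :=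
  measureReal_le_one

lemma wordEntropy_eq (μ : ProbabilityMeasure X) (n : ℕ) :
    wordEntropy X μ n = ∑ w : Fin n → A, Real.negMulLog (cylMass μ w) := rfl

lemma wordEntropy_nonneg (μ : ProbabilityMeasure X) (n : ℕ) : 0 ≤ wordEntropy X μ n :=
  Finset.sum_nonneg fun w _ => Real.negMulLog_nonneg (cylMass_nonneg μ w) (cylMass_le_one μ w)

lemma bddBelow_entropy (μ : ProbabilityMeasure X) :
    BddBelow (range fun n : ℕ => wordEntropy X μ (n + 1) / (n + 1)) :=
  ⟨0, by rintro _ ⟨n, rfl⟩; exact div_nonneg (wordEntropy_nonneg μ _) (by positivity)⟩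

lemma entropy_nonneg (μ : ProbabilityMeasure X) : 0 ≤ entropy X μ :=
  le_ciInf fun _ => div_nonneg (wordEntropy_nonneg μ _) (by positivity)

lemma entropy_mul_le (μ : ProbabilityMeasure X) (m : ℕ) :
    entropy X μ * m ≤ wordEntropy X μ m := by
  rcases m with _ | m
  · simpa using wordEntropy_nonneg μ 0
  · have : entropy X μ ≤ wordEntropy X μ (m + 1) / (m + 1) := ciInf_le (bddBelow_entropy μ) m
    rw [le_div_iff₀ (by positivity)] at this
    exact_mod_cast this

lemma integral_initial (μ : ProbabilityMeasure X) {n : ℕ} (g : (Fin n → A) → ℝ) :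
    ∫ x : X, g (initial n x.1) ∂μ.toMeasure = ∑ w, cylMass μ w * g w := by
  have hm : Measurable fun x : X => initial n x.1 := (continuous_initial n).measurable
  rw [← integral_map (φ := fun x : X => initial n x.1) hm.aemeasurable
    (by fun_prop), integral_fintype Integrable.of_finite]
  refine Finset.sum_congr rfl fun w _ => ?_
  rw [smul_eq_mul, map_measureReal_apply hm (measurableSet_singleton w)]
  congr 2
  ext x
  simp [mem_cylF_iff]

lemma sum_cylMass (μ : ProbabilityMeasure X) (n : ℕ) : ∑ w : Fin n → A, cylMass μ w = 1 := by
  have := integral_initial μ (n := n) fun _ => 1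
  simpa using this.symm

lemma sum_snoc {n : ℕ} (g : (Fin (n + 1) → A) → ℝ) :
    ∑ w, g w = ∑ w : Fin n → A, ∑ a : A, g (Fin.snoc w a) := by
  rw [← (Fin.snocEquiv fun _ : Fin (n + 1) => A).sum_comp, Fintype.sum_prod_type, Finset.sum_comm]
  rfl

lemma initial_succ (n : ℕ) (x : ℕ → A) : initial (n + 1) x = Fin.snoc (initial n x) (x n) := by
  ext i
  refine Fin.lastCases ?_ (fun i => ?_) i
  · simp [initial]
  · simp [initial]

lemma sum_cylMass_snoc (μ : ProbabilityMeasure X) {n : ℕ} (w : Fin n → A) :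
    ∑ a : A, cylMass μ (Fin.snoc w a : Fin (n + 1) → A) = cylMass μ w := by
  have h1 := integral_initial μ (n := n) fun v => if v = w then 1 else 0
  have h2 := integral_initial μ (n := n + 1) fun v => if Fin.init v = w then 1 else 0
  have h3 : ∀ x : X, Fin.init (initial (n + 1) x.1) = initial n x.1 := by
    intro x; rw [initial_succ, Fin.init_snoc]
  simp only [h3] at h2
  rw [h1, sum_snoc] at h2
  simp only [Fin.init_snoc, mul_ite, mul_one, mul_zero, Finset.sum_ite_eq', Finset.mem_univ,
    if_true] at h2
  rw [h2, Finset.sum_eq_single w]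
  · simp
  · intro b _ hb; simp [hb]
  · simp

/-- Smoothed conditional probability of the letter `a` following the word `w`. -/
noncomputable def condProb (μ : ProbabilityMeasure X) (θ : ℝ) {n : ℕ} (w : Fin n → A) (a : A) : ℝ :=
  if cylMass μ w = 0 then (Fintype.card A : ℝ)⁻¹
  else (1 - θ) * (cylMass μ (Fin.snoc w a : Fin (n + 1) → A) / cylMass μ w) +
    θ * (Fintype.card A : ℝ)⁻¹

lemma condProb_pos (μ : ProbabilityMeasure X) {θ : ℝ} (h0 : 0 < θ) (h1 : θ < 1) {n : ℕ}
    (w : Fin n → A) (a : A) : 0 < condProb μ θ w a := by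
  have : Nonempty A := ⟨a⟩
  have hc : (0 : ℝ) < (Fintype.card A : ℝ)⁻¹ := by
    have : 0 < Fintype.card A := Fintype.card_pos
    positivity
  unfold condProb
  split_ifs with h
  · exact hc
  · have := div_nonneg (cylMass_nonneg μ (Fin.snoc w a : Fin (n + 1) → A)) (cylMass_nonneg μ w)
    have : 0 < 1 - θ := by linarith
    positivity

lemma sum_condProb [Nonempty A] (μ : ProbabilityMeasure X) (θ : ℝ) {n : ℕ} (w : Fin n → A) :
    ∑ a, condProb μ θ w a = 1 := by
  have hc : (Fintype.card A : ℝ) ≠ 0 := by exact_mod_cast Fintype.card_ne_zero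
  unfold condProb
  split_ifs with h
  · simp [hc]
  · rw [Finset.sum_add_distrib, ← Finset.mul_sum, ← Finset.sum_div, sum_cylMass_snoc, div_self h]
    simp
    field_simp
    ring

/-- Product of conditional probabilities along a sequence. -/
noncomputable def condProd (q : {n : ℕ} → (Fin n → A) → A → ℝ) (j n : ℕ) (x : ℕ → A) : ℝ :=
  ∏ i ∈ Finset.range n, q (initial j (shift^[i] x)) (x (i + j))

/-- Extension of a finite word to a sequence. -/
noncomputable def extend [Nonempty A] {n : ℕ} (u : Fin n → A) : ℕ → A :=
  fun i => if h : i < n then u ⟨i, h⟩ else Classical.arbitrary A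

lemma initial_extend [Nonempty A] {n : ℕ} (u : Fin n → A) : initial n (extend u) = u := by
  ext i; simp [initial, extend]

lemma condProd_congr (q : {n : ℕ} → (Fin n → A) → A → ℝ) {j n : ℕ} {x y : ℕ → A}
    (h : initial (n + j) x = initial (n + j) y) : condProd q j n x = condProd q j n y := by
  rw [initial_eq_iff] at h
  refine Finset.prod_congr rfl fun i hi => ?_
  rw [Finset.mem_range] at hi
  congr 1
  · rw [initial_eq_iff]
    intro k hk
    rw [shift_iterate_apply, shift_iterate_apply]
    exact h _ (by omega)
  · exact h _ (by omega)

lemma sum_condProd [Nonempty A] (q : {n : ℕ} → (Fin n → A) → A → ℝ)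
    (j : ℕ) (hq : ∀ w : Fin j → A, ∑ a, q w a = 1) (n : ℕ) :
    ∑ u : Fin (j + n) → A, condProd q j n (extend u) = (Fintype.card A : ℝ) ^ j := by
  induction n with
  | zero => simp [condProd]
  | succ n ih =>
    rw [← ih]
    have := sum_snoc (n := j + n) fun u => condProd q j (n + 1) (extend u)
    refine this.trans (Finset.sum_congr rfl fun u _ => ?_)
    have h1 : ∀ a, initial (j + n) (extend (Fin.snoc u a : Fin (j + n + 1) → A)) =
        initial (j + n) (extend u) := by
      intro a
      have h := initial_extend (Fin.snoc u a : Fin (j + n + 1) → A)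
      rw [initial_succ] at h
      rw [initial_extend]
      simpa using congrArg Fin.init h
    have h2 : ∀ a, extend (Fin.snoc u a : Fin (j + n + 1) → A) (n + j) = a := by
      intro a
      have h := initial_extend (Fin.snoc u a : Fin (j + n + 1) → A)
      rw [initial_succ] at h
      have := congrFun h (Fin.last _)
      simp only [Fin.snoc_last] at this
      rw [add_comm n j]; exact this
    have h3 : ∀ a, condProd q j (n + 1) (extend (Fin.snoc u a : Fin (j + n + 1) → A)) =
        condProd q j n (extend u) * q (initial j (shift^[n] (extend u))) a := by
      intro a
      have e : condProd q j (n + 1) (extend (Fin.snoc u a : Fin (j + n + 1) → A)) =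
          condProd q j n (extend (Fin.snoc u a : Fin (j + n + 1) → A)) *
          q (initial j (shift^[n] (extend (Fin.snoc u a : Fin (j + n + 1) → A))))
            (extend (Fin.snoc u a : Fin (j + n + 1) → A) (n + j)) := Finset.prod_range_succ _ _
      rw [e, h2]
      congr 1
      · exact condProd_congr q (by rw [add_comm n j]; exact h1 a)
      · congr 1
        rw [initial_eq_iff]
        intro k hk
        rw [shift_iterate_apply, shift_iterate_apply]
        exact initial_eq_iff.1 (h1 a) _ (by omega)
    simp only [h3, ← Finset.mul_sum, hq, mul_one]

lemma sum_condProd_le [Nonempty A] (q : {n : ℕ} → (Fin n → A) → A → ℝ) (j : ℕ)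
    (hq0 : ∀ (w : Fin j → A) a, 0 ≤ q w a)
    (hq : ∀ w : Fin j → A, ∑ a, q w a = 1) (n : ℕ) (T : Finset X)
    (hT : Set.InjOn (fun x : X => prefixWord x.1 n) T) :
    ∑ x ∈ T, condProd q j n x.1 ≤ (Fintype.card A : ℝ) ^ j := by
  rw [← sum_condProd q j hq n]
  have e : ∀ x : X, condProd q j n x.1 = condProd q j n (extend (initial (j + n) x.1)) := fun x =>
    condProd_congr q (by rw [add_comm n j, initial_extend])
  simp only [e]
  have hinj : Set.InjOn (fun x : X => initial (j + n) x.1) T := by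
    intro x hx y hy hxy
    refine hT hx hy ?_
    rw [prefixWord_eq_iff]
    intro i hi
    exact initial_eq_iff.1 hxy i (by omega)
  rw [← Finset.sum_image (f := fun u => condProd q j n (extend u)) hinj]
  exact Finset.sum_le_sum_of_subset_of_nonneg (Finset.subset_univ _) fun u _ _ =>
    Finset.prod_nonneg fun i _ => hq0 _ _

/-- A continuous function whose integral is close to the entropy and whose Birkhoff sums
control the number of words. -/
lemma exists_entropy_function [Nonempty A] (hXinv : Set.MapsTo shift X X)
    (μ : ProbabilityMeasure X) {κ : ℝ} (hκ : 0 < κ) :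
    ∃ (f : X → ℝ) (C : ℝ), Continuous f ∧ ∫ x, f x ∂μ.toMeasure ≤ entropy X μ + κ ∧
      ∀ (n : ℕ) (T : Finset X), Set.InjOn (fun x : X => prefixWord x.1 n) T →
        ∑ x ∈ T, Real.exp (-birkhoff (subShift X) f n x) ≤ C := by
  obtain ⟨N, hN⟩ := exists_lt_of_ciInf_lt (show (⨅ n : ℕ, wordEntropy X μ (n + 1) / (n + 1)) <
    entropy X μ + κ / 2 from by change entropy X μ < _; linarith)
  rw [div_lt_iff₀ (by positivity)] at hN
  have H0 : wordEntropy X μ 0 = 0 := by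
    have := sum_cylMass μ 0
    rw [wordEntropy_eq]
    simp only [Finset.univ_unique, Finset.sum_singleton] at this ⊢
    rw [this, Real.negMulLog_one]
  obtain ⟨j, -, hj⟩ : ∃ j ∈ Finset.range (N + 1),
      wordEntropy X μ (j + 1) - wordEntropy X μ j < entropy X μ + κ / 2 := by
    apply Finset.exists_lt_of_sum_lt
    rw [Finset.sum_range_sub, H0, sub_zero]
    refine hN.trans_le (le_of_eq ?_)
    simp
    ring
  set θ : ℝ := 1 - Real.exp (-(κ / 2)) with hθ
  have hθ0 : 0 < θ := by
    have : Real.exp (-(κ / 2)) < 1 := by rw [Real.exp_lt_one_iff]; linarith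
    linarith
  have hθ1 : θ < 1 := by have := Real.exp_pos (-(κ / 2)); linarith
  set g : (Fin (j + 1) → A) → ℝ :=
    fun v => -Real.log (condProb μ θ (Fin.init v : Fin j → A) (v (Fin.last j))) with hg
  refine ⟨fun x => g (initial (j + 1) x.1), (Fintype.card A : ℝ) ^ j, ?_, ?_, ?_⟩
  · exact (continuous_of_discreteTopology (f := g)).comp (continuous_initial (j + 1))
  · rw [integral_initial]
    have key : ∑ v, cylMass μ v * g v ≤
        ∑ v : Fin (j + 1) → A, (Real.negMulLog (cylMass μ v) +
          cylMass μ v * Real.log (cylMass μ (Fin.init v : Fin j → A)) + cylMass μ v * (κ / 2)) := by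
      refine Finset.sum_le_sum fun v _ => ?_
      rcases (cylMass_nonneg μ v).eq_or_lt with h | h
      · simp [← h]
      · have hv : Fin.snoc (Fin.init v : Fin j → A) (v (Fin.last j)) = v := Fin.snoc_init_self v
        have hw : cylMass μ v ≤ cylMass μ (Fin.init v : Fin j → A) := by
          rw [← sum_cylMass_snoc μ (Fin.init v : Fin j → A)]
          conv_lhs => rw [← hv]
          exact Finset.single_le_sum (f := fun a => cylMass μ
            (Fin.snoc (Fin.init v : Fin j → A) a : Fin (j + 1) → A))
            (fun a _ => cylMass_nonneg _ _) (Finset.mem_univ (v (Fin.last j)))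
        have hw0 := h.trans_le hw
        have hq : Real.exp (-(κ / 2)) * (cylMass μ v / cylMass μ (Fin.init v : Fin j → A)) ≤
            condProb μ θ (Fin.init v : Fin j → A) (v (Fin.last j)) := by
          unfold condProb
          rw [if_neg hw0.ne', hv]
          have : 0 ≤ θ * (Fintype.card A : ℝ)⁻¹ := by positivity
          have e : 1 - θ = Real.exp (-(κ / 2)) := by rw [hθ]; ring
          rw [e]; linarith
        have hl := Real.log_le_log (by positivity) hq
        rw [Real.log_mul (by positivity) (by positivity), Real.log_exp,
          Real.log_div h.ne' hw0.ne'] at hl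
        simp only [hg, Real.negMulLog]
        nlinarith
    refine key.trans ?_
    rw [Finset.sum_add_distrib, Finset.sum_add_distrib, ← Finset.sum_mul, sum_cylMass,
      ← wordEntropy_eq]
    have e : ∑ v : Fin (j + 1) → A, cylMass μ v * Real.log (cylMass μ (Fin.init v : Fin j → A)) =
        -wordEntropy X μ j := by
      rw [sum_snoc, wordEntropy_eq, ← Finset.sum_neg_distrib]
      refine Finset.sum_congr rfl fun w _ => ?_
      simp only [Fin.init_snoc]
      rw [← Finset.sum_mul, sum_cylMass_snoc, Real.negMulLog]
      ring
    rw [e]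
    linarith
  · intro n T hT
    have e : ∀ x : X, Real.exp (-birkhoff (subShift X) (fun x => g (initial (j + 1) x.1)) n x) =
        condProd (fun w a => condProb μ θ w a) j n x.1 := by
      intro x
      rw [birkhoff, ← Finset.sum_neg_distrib, Real.exp_sum, condProd]
      refine Finset.prod_congr rfl fun i _ => ?_
      rw [subShift_iterate_val hXinv]
      simp only [hg, initial_succ, neg_neg, Fin.init_snoc, Fin.snoc_last]
      rw [Real.exp_log (condProb_pos μ hθ0 hθ1 _ _), shift_iterate_apply, add_comm j i]
    simp only [e]
    exact sum_condProd_le _ j (fun w a => (condProb_pos μ hθ0 hθ1 w a).le)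
      (fun w => sum_condProb μ θ w) n T hT

end CondEntropy

/-! ### Upper bound -/

section UpperBound

variable {X : Set (ℕ → A)}

lemma exists_pos_le (hXcl : IsClosed X) {φ : X → ℝ} (hφ : Continuous φ) (hφpos : ∀ x, 0 < φ x) :
    ∃ c : ℝ, 0 < c ∧ ∀ x, c ≤ φ x := by
  have : CompactSpace X := isCompact_iff_compactSpace.1 hXcl.isCompact
  rcases isEmpty_or_nonempty X with h | h
  · exact ⟨1, one_pos, fun x => h.elim x⟩
  · obtain ⟨x, -, hx⟩ := isCompact_univ.exists_isMinOn univ_nonempty hφ.continuousOn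
    exact ⟨φ x, hφpos x, fun y => hx (mem_univ y)⟩

lemma finite_range_prefixWord (n : ℕ) : (range fun x : ℕ → A => prefixWord x n).Finite := by
  have : (fun x : ℕ → A => prefixWord x n) = (fun w : Fin n → A => List.ofFn w) ∘ initial n := by
    funext x
    rfl
  rw [this]
  exact (finite_range _).subset (range_comp_subset_range _ _)

lemma exists_finset_prefixWord (n : ℕ) (S : Set X) :
    ∃ T : Finset X, ↑T ⊆ S ∧ InjOn (fun x : X => prefixWord x.1 n) T ∧
      ∀ x ∈ S, ∃ y ∈ T, prefixWord x.1 n = prefixWord y.1 n := by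
  obtain ⟨T, hTS, hT⟩ := exists_subset_bijOn S fun x : X => prefixWord x.1 n
  have hfin : T.Finite := by
    refine Finite.of_finite_image ?_ hT.injOn
    refine (finite_range_prefixWord (A := A) n).subset ?_
    rintro _ ⟨x, -, rfl⟩
    exact ⟨x.1, rfl⟩
  refine ⟨hfin.toFinset, by simpa using hTS, by simpa using hT.injOn, fun x hx => ?_⟩
  obtain ⟨y, hy, hxy⟩ := hT.surjOn (mem_image_of_mem _ hx)
  exact ⟨y, by simpa using hy, hxy.symm⟩

lemma hMeas_frequently_eq_zero (hXcl : IsClosed X) (hXinv : Set.MapsTo shift X X)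
    {φ : X → ℝ} (hφ : Continuous φ) (hφpos : ∀ x, 0 < φ x) {f : X → ℝ} {C : ℝ}
    (hf : ∀ (n : ℕ) (T : Finset X), InjOn (fun x : X => prefixWord x.1 n) T →
        ∑ x ∈ T, Real.exp (-birkhoff (subShift X) f n x) ≤ C)
    {t κ : ℝ} (ht : 0 ≤ t) (hκ : 0 < κ) {ε : ℝ≥0∞} (hε : 0 < ε) :
    hMeasAux (dphi X φ) t ε {x | ∃ᶠ n : ℕ in atTop,
      birkhoff (subShift X) f n x - t * birkhoff (subShift X) φ n x < -κ * n} = 0 := by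
  obtain ⟨c, hc, hcφ⟩ := exists_pos_le hXcl hφ hφpos
  have hC : 0 ≤ C := by simpa using hf 0 ∅ (by simp)
  set δ : ℝ := min (κ / (2 * (t + 1))) (c / 2) with hδ
  have hδ0 : 0 < δ := lt_min (by positivity) (by positivity)
  have hδt : t * δ ≤ κ / 2 := by
    have h1 : δ ≤ κ / (2 * (t + 1)) := min_le_left _ _
    rw [le_div_iff₀ (by positivity)] at h1
    nlinarith
  have hδc : δ ≤ c / 2 := min_le_right _ _
  obtain ⟨C₁, hC₁, hdiam⟩ := exists_ediam_cylinder_le hXcl hXinv hφ hφpos hδ0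
  set r : ℝ := Real.exp (-(κ / 2)) with hr
  have hr0 : 0 < r := Real.exp_pos _
  have hr1 : r < 1 := by rw [hr, Real.exp_lt_one_iff]; linarith
  set bad : ℕ → Set X := fun n =>
    {x | birkhoff (subShift X) f n x - t * birkhoff (subShift X) φ n x < -κ * n} with hbad
  choose T hTbad hTinj hTcov using fun n => exists_finset_prefixWord (X := X) n (bad n)
  set K : ℝ := Real.exp (t * C₁) * C with hK
  have hK0 : 0 ≤ K := by positivity
  have hsmall : ∀ᶠ N : ℕ in atTop, ∀ n, N ≤ n →
      ENNReal.ofReal (Real.exp (-(c / 2) * n + C₁)) ≤ ε := by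
    have h1 : Tendsto (fun n : ℕ => ENNReal.ofReal (Real.exp (-(c / 2) * n + C₁))) atTop (𝓝 0) := by
      rw [← ENNReal.ofReal_zero]
      refine ENNReal.tendsto_ofReal (Real.tendsto_exp_atBot.comp ?_)
      refine tendsto_atBot_add_const_right _ _ ?_
      exact tendsto_natCast_atTop_atTop.const_mul_atTop_of_neg (by linarith)
    obtain ⟨N, hN⟩ := eventually_atTop.1 (h1.eventually_le_const hε)
    filter_upwards [eventually_ge_atTop N] with M hM n hn using hN n (hM.trans hn)
  have hbound : ∀ᶠ N : ℕ in atTop, hMeasAux (dphi X φ) t ε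
      {x | ∃ᶠ n : ℕ in atTop, x ∈ bad n} ≤ ENNReal.ofReal (K * (r ^ N * (1 - r)⁻¹)) := by
    filter_upwards [hsmall] with N hN
    have hlen : ∀ (n : ℕ) (x : X), ediam (dphi X φ)
        {z : X | prefixWord z.1 (N + n) = prefixWord x.1 (N + n)} ≤ ε := by
      intro n x
      refine (hdiam x (N + n)).trans (le_trans ?_ (hN (N + n) (by omega)))
      refine ENNReal.ofReal_le_ofReal (Real.exp_le_exp.2 ?_)
      have := le_birkhoff (subShift X) φ hcφ (N + n) x
      have hn : (0 : ℝ) ≤ ((N + n : ℕ) : ℝ) := by positivity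
      nlinarith
    refine (hMeasAux_le_tsum (dphi X φ) (ι := Σ n : ℕ, T (N + n)) t ε
      (fun p => {z : X | prefixWord z.1 (N + p.1) = prefixWord p.2.1.1 (N + p.1)}) ?_
      (fun p => hlen p.1 p.2.1)).trans ?_
    · intro x hx
      obtain ⟨n, hn, hxn⟩ := frequently_atTop.1 hx N
      obtain ⟨m, rfl⟩ := Nat.exists_eq_add_of_le hn
      obtain ⟨y, hy, hxy⟩ := hTcov _ x hxn
      exact mem_iUnion.2 ⟨⟨m, ⟨y, hy⟩⟩, hxy⟩
    · have hterm : ∀ p : (Σ n : ℕ, T (N + n)),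
          (⨆ (_ : {z : X | prefixWord z.1 (N + p.1) = prefixWord p.2.1.1 (N + p.1)}.Nonempty),
            ediam (dphi X φ) {z : X | prefixWord z.1 (N + p.1) =
              prefixWord p.2.1.1 (N + p.1)} ^ t) ≤
          ENNReal.ofReal (Real.exp (t * C₁) * r ^ (N + p.1) *
            Real.exp (-birkhoff (subShift X) f (N + p.1) p.2.1)) := by
        rintro ⟨n, x, hx⟩
        refine iSup_le fun _ => ?_
        refine (ENNReal.rpow_le_rpow (hdiam x (N + n)) ht).trans ?_
        rw [ENNReal.ofReal_rpow_of_pos (Real.exp_pos _)]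
        refine ENNReal.ofReal_le_ofReal ?_
        rw [← Real.exp_mul, hr, ← Real.exp_nat_mul, ← Real.exp_add, ← Real.exp_add, Real.exp_le_exp]
        have hb : birkhoff (subShift X) f (N + n) x - t * birkhoff (subShift X) φ (N + n) x <
          -κ * ((N + n : ℕ) : ℝ) := hTbad _ hx
        have hn : (0 : ℝ) ≤ ((N + n : ℕ) : ℝ) := by positivity
        have := mul_le_mul_of_nonneg_right hδt hn
        dsimp only
        nlinarith
      refine (ENNReal.tsum_le_tsum hterm).trans ?_
      rw [ENNReal.tsum_sigma (β := fun n : ℕ => T (N + n))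
        (fun n x => ENNReal.ofReal (Real.exp (t * C₁) * r ^ (N + n) *
          Real.exp (-birkhoff (subShift X) f (N + n) x.1)))]
      have hinner : ∀ n : ℕ, ∑' x : T (N + n), ENNReal.ofReal (Real.exp (t * C₁) * r ^ (N + n) *
            Real.exp (-birkhoff (subShift X) f (N + n) x.1)) ≤
            ENNReal.ofReal (K * r ^ N * r ^ n) := by
        intro n
        rw [Finset.tsum_subtype (T (N + n)) fun x => ENNReal.ofReal (Real.exp (t * C₁) *
          r ^ (N + n) * Real.exp (-birkhoff (subShift X) f (N + n) x)),
          ← ENNReal.ofReal_sum_of_nonneg fun x _ => by positivity]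
        refine ENNReal.ofReal_le_ofReal ?_
        rw [← Finset.mul_sum]
        have := hf (N + n) (T (N + n)) (hTinj _)
        calc Real.exp (t * C₁) * r ^ (N + n) * _ ≤ Real.exp (t * C₁) * r ^ (N + n) * C := by
              gcongr
          _ = K * r ^ N * r ^ n := by rw [hK, pow_add]; ring
      refine (ENNReal.tsum_le_tsum hinner).trans ?_
      rw [← ENNReal.ofReal_tsum_of_nonneg (fun n => by positivity)
        ((summable_geometric_of_lt_one hr0.le hr1).mul_left _), tsum_mul_left,
        tsum_geometric_of_lt_one hr0.le hr1, mul_assoc]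
  have hlim : Tendsto (fun N : ℕ => ENNReal.ofReal (K * (r ^ N * (1 - r)⁻¹))) atTop (𝓝 0) := by
    rw [← ENNReal.ofReal_zero]
    refine ENNReal.tendsto_ofReal ?_
    have := ((tendsto_pow_atTop_nhds_zero_of_lt_one hr0.le hr1).mul_const (1 - r)⁻¹).const_mul K
    simpa using this
  exact le_antisymm (ge_of_tendsto hlim hbound) bot_le

/-- The empirical probability measure of `x` at time `n + 1`. -/
lemma exists_empirical (x : X) (n : ℕ) : ∃ μ : ProbabilityMeasure X,
    ∀ f : X → ℝ, Continuous f →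
      ∫ y, f y ∂μ.toMeasure = birkAvg (subShift X) f (n + 1) x := by
  have hp : IsProbabilityMeasure (empiric (subShift X) (n + 1) x) := by
    constructor
    simp only [empiric, Measure.smul_apply, Measure.finsetSum_apply, measure_univ,
      Finset.sum_const, Finset.card_range, smul_eq_mul, nsmul_eq_mul, mul_one]
    exact ENNReal.inv_mul_cancel (by simp) (by simp)
  refine ⟨⟨_, hp⟩, fun f hf => ?_⟩
  change ∫ y, f y ∂(empiric (subShift X) (n + 1) x) = _
  rw [empiric, integral_smul_measure, integral_finsetSum_measure]
  · simp only [birkAvg, birkhoff, integral_dirac, smul_eq_mul, ENNReal.toReal_inv,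
      ENNReal.toReal_natCast]
  · intro i _
    exact integrable_dirac (by simp)

lemma tendsto_birkAvg_comp_sub (hXcl : IsClosed X) {f : X → ℝ} (hf : Continuous f) (x : X) :
    Tendsto (fun n : ℕ => birkAvg (subShift X) (f ∘ subShift X) (n + 1) x -
      birkAvg (subShift X) f (n + 1) x) atTop (𝓝 0) := by
  obtain ⟨M, hM0, hM⟩ := exists_abs_le hXcl hf
  have h1 : ∀ n : ℕ, birkAvg (subShift X) (f ∘ subShift X) (n + 1) x -
      birkAvg (subShift X) f (n + 1) x =
      ((n : ℝ) + 1)⁻¹ * (f ((subShift X)^[n + 1] x) - f x) := by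
    intro n
    have := Finset.sum_range_sub (fun i => f ((subShift X)^[i] x)) (n + 1)
    simp only [birkAvg, birkhoff, ← mul_sub, ← Finset.sum_sub_distrib]
    push_cast
    congr 1
    rw [← show f ((subShift X)^[0] x) = f x from rfl, ← this]
    refine Finset.sum_congr rfl fun i _ => ?_
    rw [Function.comp, ← Function.iterate_succ_apply' (subShift X) i x]
  simp only [h1]
  refine squeeze_zero_norm (a := fun n : ℕ => 1 / ((n : ℝ) + 1) * (2 * M)) (fun n => ?_) ?_
  · rw [norm_mul, Real.norm_eq_abs, Real.norm_eq_abs, abs_of_nonneg (by positivity), one_div]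
    gcongr
    have := abs_sub (f ((subShift X)^[n + 1] x)) (f x)
    have h2 := hM ((subShift X)^[n + 1] x)
    have h3 := hM x
    linarith
  · simpa using tendsto_one_div_add_atTop_nhds_zero_nat.mul_const (2 * M)

lemma isInvariant_of_forall_integral (hXinv : Set.MapsTo shift X X) {μ : ProbabilityMeasure X}
    (h : ∀ f : C(X, ℝ), ∫ x, f (subShift X x) ∂μ.toMeasure = ∫ x, f x ∂μ.toMeasure) :
    IsInvariant (subShift X) μ := by
  have hm : Measurable (subShift X) := (continuous_subShift hXinv).measurable
  have : IsFiniteMeasure (μ.toMeasure.map (subShift X)) :=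
    Measure.isFiniteMeasure_map _ _
  refine ext_of_forall_integral_eq_of_IsFiniteMeasure fun f => ?_
  rw [integral_map hm.aemeasurable f.continuous.aestronglyMeasurable]
  exact h f.toContinuousMap

lemma IsInvariant.integral_comp (hXinv : Set.MapsTo shift X X) {μ : ProbabilityMeasure X}
    (h : IsInvariant (subShift X) μ) {f : X → ℝ} (hf : Continuous f) :
    ∫ x, f (subShift X x) ∂μ.toMeasure = ∫ x, f x ∂μ.toMeasure := by
  have hm : Measurable (subShift X) := (continuous_subShift hXinv).measurable
  rw [← integral_map (φ := subShift X) hm.aemeasurable hf.aestronglyMeasurable]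
  rw [show μ.toMeasure.map (subShift X) = μ.toMeasure from h]

lemma continuous_integral_toMeasure (hXcl : IsClosed X) {f : X → ℝ} (hf : Continuous f) :
    Continuous fun μ : ProbabilityMeasure X => ∫ x, f x ∂μ.toMeasure := by
  have : CompactSpace X := isCompact_iff_compactSpace.1 hXcl.isCompact
  exact ProbabilityMeasure.continuous_integral_continuousMap (X := X) (⟨f, hf⟩ : C(X, ℝ))

lemma integrable_of_continuous (hXcl : IsClosed X) (μ : ProbabilityMeasure X) {f : X → ℝ}
    (hf : Continuous f) : Integrable f μ.toMeasure := by
  obtain ⟨M, -, hM⟩ := exists_abs_le hXcl hf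
  exact Integrable.of_bound hf.aestronglyMeasurable M (Eventually.of_forall hM)

/-- Every point of the level set has an invariant limit measure in a cluster sense. -/
lemma exists_invariant_cluster (hXcl : IsClosed X) (hXinv : Set.MapsTo shift X X)
    {ψ : X → ℝ} (hψ : Continuous ψ) {α : ℝ} {x : X} (hx : x ∈ levelSet (subShift X) ψ α) :
    ∃ μ : ProbabilityMeasure X, IsInvariant (subShift X) μ ∧ ∫ y, ψ y ∂μ.toMeasure = α ∧
      ∀ F : X → ℝ, Continuous F → ∀ κ : ℝ, ∫ y, F y ∂μ.toMeasure < κ →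
        ∃ᶠ n : ℕ in atTop, birkAvg (subShift X) F n x < κ := by
  have : CompactSpace X := isCompact_iff_compactSpace.1 hXcl.isCompact
  choose ν hν using fun n => exists_empirical x n
  obtain ⟨μ, hμ⟩ := exists_clusterPt_of_compactSpace (map ν atTop)
  have hcl : MapClusterPt μ atTop ν := hμ
  have hlim : ∀ F : X → ℝ, Continuous F → ∀ a : ℝ,
      Tendsto (fun n : ℕ => birkAvg (subShift X) F (n + 1) x) atTop (𝓝 a) →
        ∫ y, F y ∂μ.toMeasure = a := by
    intro F hF a ha
    have h1 := hcl.tendsto_comp (continuous_integral_toMeasure hXcl hF).continuousAt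
    have h2 : MapClusterPt (∫ y, F y ∂μ.toMeasure) atTop
        (fun n : ℕ => birkAvg (subShift X) F (n + 1) x) := by
      convert h1 using 1
      funext n
      exact (hν n F hF).symm
    exact eq_of_nhds_neBot (NeBot.mono h2 (inf_le_inf_left _ ha))
  refine ⟨μ, ?_, ?_, ?_⟩
  · refine isInvariant_of_forall_integral hXinv fun f => ?_
    have hfσ : Continuous fun y => f (subShift X y) := f.continuous.comp (continuous_subShift hXinv)
    have h0 := hlim (fun y => f (subShift X y) - f y) (hfσ.sub f.continuous) 0 (by
      refine (tendsto_birkAvg_comp_sub hXcl f.continuous x).congr fun n => ?_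
      simp only [birkAvg, birkhoff, Finset.sum_sub_distrib, Function.comp, mul_sub])
    rw [integral_sub (integrable_of_continuous hXcl μ hfσ)
      (integrable_of_continuous hXcl μ f.continuous)] at h0
    linarith
  · exact hlim ψ hψ α ((tendsto_add_atTop_iff_nat 1).2 hx)
  · intro F hF κ hκ
    have h1 := hcl.tendsto_comp (continuous_integral_toMeasure hXcl hF).continuousAt
    have h2 := h1.frequently (Iio_mem_nhds hκ)
    have h3 : ∃ᶠ n : ℕ in atTop, birkAvg (subShift X) F (n + 1) x < κ := by
      refine h2.mono fun n hn => ?_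
      rw [← hν n F hF]
      exact hn
    rw [← frequently_map (m := fun n => n + 1) (P := fun n => birkAvg (subShift X) F n x < κ)] at h3
    exact h3.filter_mono (tendsto_add_atTop_nat 1)

lemma isClosed_invariant (hXcl : IsClosed X) (hXinv : Set.MapsTo shift X X)
    {ψ : X → ℝ} (hψ : Continuous ψ) (α : ℝ) :
    IsClosed {μ : ProbabilityMeasure X |
      IsInvariant (subShift X) μ ∧ ∫ y, ψ y ∂μ.toMeasure = α} := by
  have e : {μ : ProbabilityMeasure X | IsInvariant (subShift X) μ ∧ ∫ y, ψ y ∂μ.toMeasure = α} =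
      (⋂ f : C(X, ℝ), {μ | ∫ x, f (subShift X x) ∂μ.toMeasure = ∫ x, f x ∂μ.toMeasure}) ∩
      {μ | ∫ y, ψ y ∂μ.toMeasure = α} := by
    ext μ
    simp only [mem_inter_iff, mem_iInter, mem_ofPred_eq]
    exact and_congr_left fun _ => ⟨fun h f => h.integral_comp hXinv f.continuous,
      fun h => isInvariant_of_forall_integral hXinv h⟩
  rw [e]
  refine (isClosed_iInter fun f => isClosed_eq ?_ ?_).inter (isClosed_eq ?_ continuous_const)
  · exact continuous_integral_toMeasure hXcl (f.continuous.comp (continuous_subShift hXinv))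
  · exact continuous_integral_toMeasure hXcl f.continuous
  · exact continuous_integral_toMeasure hXcl hψ

/-- Upper bound for the Hausdorff measure of level sets. -/
lemma hMeas_levelSet_eq_zero (hXcl : IsClosed X) (hXinv : Set.MapsTo shift X X)
    {φ : X → ℝ} (hφ : Continuous φ) (hφpos : ∀ x, 0 < φ x) {ψ : X → ℝ} (hψ : Continuous ψ)
    {α t : ℝ} (ht : 0 ≤ t)
    (h : ∀ μ : ProbabilityMeasure X, IsInvariant (subShift X) μ → ∫ y, ψ y ∂μ.toMeasure = α →
      entropy X μ < t * ∫ y, φ y ∂μ.toMeasure) :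
    hMeas (dphi X φ) t (levelSet (subShift X) ψ α) = 0 := by
  have : CompactSpace X := isCompact_iff_compactSpace.1 hXcl.isCompact
  rw [hMeas_eq_zero_iff]
  intro ε hε
  rcases isEmpty_or_nonempty X with hX | ⟨⟨x₀⟩⟩
  · refine le_antisymm ((hMeasAux_le_tsum _ (ι := Empty) t ε (fun _ => ∅) ?_ ?_).trans (by simp))
      bot_le
    · intro x; exact hX.elim x
    · simp
  have : Nonempty A := ⟨x₀.1 0⟩
  set K : Set (ProbabilityMeasure X) :=
    {μ | IsInvariant (subShift X) μ ∧ ∫ y, ψ y ∂μ.toMeasure = α} with hK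
  have hKc : IsCompact K := (isClosed_invariant hXcl hXinv hψ α).isCompact
  have hloc : ∀ μ : ProbabilityMeasure X, ∃ (f : X → ℝ) (C κ : ℝ), μ ∈ K → 0 < κ ∧ Continuous f ∧
      ∫ x, (f x - t * φ x) ∂μ.toMeasure < -κ ∧
      ∀ (n : ℕ) (T : Finset X), Set.InjOn (fun x : X => prefixWord x.1 n) T →
        ∑ x ∈ T, Real.exp (-birkhoff (subShift X) f n x) ≤ C := by
    intro μ
    by_cases hμ : μ ∈ K
    · have hgap := h μ hμ.1 hμ.2
      set κ := (t * ∫ y, φ y ∂μ.toMeasure - entropy X μ) / 3 with hκ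
      have hκ0 : 0 < κ := by rw [hκ]; linarith
      obtain ⟨f, C, hf, hint, hcount⟩ := exists_entropy_function hXinv μ hκ0
      refine ⟨f, C, κ, fun _ => ⟨hκ0, hf, ?_, hcount⟩⟩
      rw [integral_sub (integrable_of_continuous hXcl μ hf)
        ((integrable_of_continuous hXcl μ hφ).const_mul t), integral_const_mul]
      linarith
    · exact ⟨0, 0, 0, fun h => absurd h hμ⟩
  choose f C κ hfC using hloc
  obtain ⟨I, hIK, hcov⟩ := hKc.elim_nhds_subcover
    (fun μ => if μ ∈ K then {ν : ProbabilityMeasure X |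
      ∫ x, (f μ x - t * φ x) ∂ν.toMeasure < -κ μ} else univ) (by
    intro μ hμ
    rw [if_pos hμ]
    obtain ⟨h1, h2, h3, -⟩ := hfC μ hμ
    exact (continuous_integral_toMeasure hXcl (h2.sub (hφ.const_mul t))).continuousAt.eventually
      (Iio_mem_nhds h3))
  have hsub : levelSet (subShift X) ψ α ⊆ ⋃ μ : I, {x | ∃ᶠ n : ℕ in atTop,
      birkhoff (subShift X) (f μ) n x - t * birkhoff (subShift X) φ n x < -κ μ * n} := by
    intro x hx
    obtain ⟨μ, hμ1, hμ2, hμ3⟩ := exists_invariant_cluster hXcl hXinv hψ hx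
    obtain ⟨ν, hν, hμν⟩ := mem_iUnion₂.1 (hcov (show μ ∈ K from ⟨hμ1, hμ2⟩))
    rw [if_pos (hIK ν hν)] at hμν
    obtain ⟨h1, h2, -, -⟩ := hfC ν (hIK ν hν)
    refine mem_iUnion.2 ⟨⟨ν, hν⟩, ?_⟩
    refine ((hμ3 _ (h2.sub (hφ.const_mul t)) _ hμν).and_eventually
      (eventually_gt_atTop 0)).mono fun n hn => ?_
    obtain ⟨hn, hn0⟩ := hn
    have hn0' : (0 : ℝ) < n := by exact_mod_cast hn0
    rw [birkAvg, inv_mul_lt_iff₀ hn0'] at hn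
    have e : birkhoff (subShift X) (fun x => f ν x - t * φ x) n x =
        birkhoff (subShift X) (f ν) n x - t * birkhoff (subShift X) φ n x := by
      simp only [birkhoff, Finset.sum_sub_distrib, Finset.mul_sum]
    replace hn : birkhoff (subShift X) (fun x => f ν x - t * φ x) n x < n * -κ ν := hn
    rw [e] at hn
    simpa [mul_comm] using hn
  refine le_antisymm ((hMeasAux_mono _ hsub).trans (le_of_eq ?_)) bot_le
  refine hMeasAux_iUnion_eq_zero _ fun μ => ?_
  obtain ⟨h1, h2, -, h4⟩ := hfC μ.1 (hIK μ.1 μ.2)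
  exact hMeas_frequently_eq_zero hXcl hXinv hφ hφpos h4 ht h1 hε

end UpperBound

/-! ### Edit distance -/

section Edit

/-- `EditPath n v w` means that `v` can be transformed into `w` by `n` edits. -/
inductive EditPath : ℕ → List A → List A → Prop
  | refl (v : List A) : EditPath 0 v v
  | step {n : ℕ} {v w w' : List A} (h : EditPath n v w) (hs : EditStep w w') :
      EditPath (n + 1) v w'

lemma editPath_of_fun {n : ℕ} (f : ℕ → List A) (hf : ∀ i < n, EditStep (f i) (f (i + 1))) :
    EditPath n (f 0) (f n) := by
  induction n with
  | zero => exact .refl _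
  | succ n ih => exact .step (ih fun i hi => hf i (hi.trans n.lt_succ_self)) (hf n n.lt_succ_self)

lemma EditPath.exists_fun {n : ℕ} {v w : List A} (h : EditPath n v w) :
    ∃ f : ℕ → List A, f 0 = v ∧ f n = w ∧ ∀ i < n, EditStep (f i) (f (i + 1)) := by
  induction h with
  | refl v => exact ⟨fun _ => v, rfl, rfl, by simp⟩
  | @step n v w w' _ hs ih =>
    obtain ⟨f, h0, hn, hf⟩ := ih
    refine ⟨fun i => if i ≤ n then f i else w', by simpa using h0, by simp, fun i hi => ?_⟩
    rcases (Nat.lt_succ_iff.1 hi).lt_or_eq with h | rfl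
    · simpa [h.le, Nat.succ_le_of_lt h] using hf i h
    · simpa [hn] using hs

lemma exists_editPath (v w : List A) : ∃ n, EditPath n v w := by
  have h1 : ∃ n, EditPath n v [] := by
    have : ∀ (u : List A) (n : ℕ), EditPath n v u → ∃ n, EditPath n v [] := by
      intro u
      induction u with
      | nil => exact fun n h => ⟨n, h⟩
      | cons a u ih => exact fun n h => ih (n + 1) (h.step (.inr (.inr ⟨[], u, a, rfl, rfl⟩)))
    exact this v 0 (.refl v)
  induction w with
  | nil => exact h1
  | cons a w ih =>
    obtain ⟨n, hn⟩ := ih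
    exact ⟨n + 1, hn.step (.inr (.inl ⟨[], w, a, rfl, rfl⟩))⟩

lemma editPath_editDist (v w : List A) : EditPath (editDist v w) v w := by
  obtain ⟨n, hn⟩ := exists_editPath v w
  obtain ⟨f, h0, hn, hf⟩ := Nat.sInf_mem (s := {n | ∃ f : ℕ → List A, f 0 = v ∧ f n = w ∧
    ∀ i < n, EditStep (f i) (f (i + 1))}) ⟨n, hn.exists_fun⟩
  have := editPath_of_fun f hf
  rw [h0, hn] at this
  exact this

lemma EditPath.exists_sublist {n : ℕ} {v w : List A} (h : EditPath n v w) :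
    ∃ s : List A, s.Sublist v ∧ s.Sublist w ∧ v.length ≤ s.length + n ∧
      w.length ≤ s.length + n := by
  induction h with
  | refl v => exact ⟨v, List.Sublist.refl _, List.Sublist.refl _, le_rfl, le_rfl⟩
  | @step n v w w' _ hs ih =>
    obtain ⟨s, hsv, hsw, h1, h2⟩ := ih
    have key : ∀ (u₁ u₂ : List A) (a : A), w = u₁ ++ [a] ++ u₂ → ∃ s₁ s₂ : List A,
        (s₁ ++ s₂).Sublist s ∧ s₁.Sublist u₁ ∧ s₂.Sublist u₂ ∧
        s.length ≤ (s₁ ++ s₂).length + 1 := by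
      rintro u₁ u₂ a rfl
      obtain ⟨s', s₂, rfl, hs', hs₂⟩ := List.sublist_append_iff.1 hsw
      obtain ⟨s₁, t, rfl, hs₁, ht⟩ := List.sublist_append_iff.1 hs'
      refine ⟨s₁, s₂, ?_, hs₁, hs₂, ?_⟩
      · exact (List.sublist_append_left s₁ t).append (List.Sublist.refl _)
      · have := ht.length_le
        simp at this ⊢
        omega
    rcases hs with ⟨u₁, u₂, a, a', rfl, rfl⟩ | ⟨u₁, u₂, a', rfl, rfl⟩ | ⟨u₁, u₂, a, rfl, rfl⟩
    · obtain ⟨s₁, s₂, hs, h3, h4, h5⟩ := key _ _ _ rfl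
      refine ⟨s₁ ++ s₂, hs.trans hsv, (h3.trans (List.sublist_append_left _ _)).append h4, ?_, ?_⟩
      · omega
      · simp at *; omega
    · refine ⟨s, hsv, hsw.trans ?_, by omega, by simp at *; omega⟩
      exact (List.sublist_append_left u₁ [a']).append (List.Sublist.refl _)
    · obtain ⟨s₁, s₂, hs, h3, h4, h5⟩ := key _ _ _ rfl
      refine ⟨s₁ ++ s₂, hs.trans hsv, h3.append h4, ?_, ?_⟩
      · omega
      · simp at *; omega

lemma exists_finset_sublist {x : ℝ} (hx : 0 < x) (hx1 : x ≤ 1) (v : List A) (k : ℕ) :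
    ∃ D : Finset (List A), (∀ s : List A, s.Sublist v → v.length ≤ s.length + k → s ∈ D) ∧
      x ^ k * D.card ≤ (1 + x) ^ v.length := by
  induction v generalizing k with
  | nil =>
    refine ⟨{[]}, fun s hs _ => by simpa using hs, ?_⟩
    simpa using pow_le_one₀ hx.le hx1
  | cons a v ih =>
    obtain ⟨D, hD, hDc⟩ := ih k
    have hcons : ∀ s : List A, s.Sublist (a :: v) → (a :: v).length ≤ s.length + k →
        (s.Sublist v) ∨ s ∈ D.image (List.cons a) := by
      intro s hs hl
      rcases List.sublist_cons_iff.1 hs with h | ⟨t, rfl, ht⟩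
      · exact .inl h
      · refine .inr (Finset.mem_image_of_mem _ (hD t ht ?_))
        simp at hl; omega
    have hcard : ((D.image (List.cons a)).card : ℝ) ≤ D.card := by
      exact_mod_cast Finset.card_image_le
    rcases k with _ | k
    · refine ⟨D.image (List.cons a), fun s hs hl => (hcons s hs hl).resolve_left fun h => ?_, ?_⟩
      · have := h.length_le
        simp at hl; omega
      · simp only [pow_zero, one_mul, List.length_cons, pow_succ] at *
        have : 0 ≤ (1 + x) ^ v.length := by positivity
        nlinarith
    · obtain ⟨D', hD', hDc'⟩ := ih k
      refine ⟨D' ∪ D.image (List.cons a), fun s hs hl => ?_, ?_⟩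
      · rw [Finset.mem_union]
        refine (hcons s hs hl).imp_left fun h => hD' s h ?_
        simp at hl; omega
      · have hu : ((D' ∪ D.image (List.cons a)).card : ℝ) ≤ D'.card + D.card :=
          (by exact_mod_cast Finset.card_union_le _ _ : ((D' ∪ D.image (List.cons a)).card : ℝ) ≤
            D'.card + (D.image (List.cons a)).card).trans (by gcongr)
        calc x ^ (k + 1) * ((D' ∪ D.image (List.cons a)).card : ℝ)
            ≤ x ^ (k + 1) * (D'.card + D.card) := by gcongr
          _ = x * (x ^ k * D'.card) + x ^ (k + 1) * D.card := by ring
          _ ≤ x * (1 + x) ^ v.length + (1 + x) ^ v.length := by gcongr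
          _ = (1 + x) ^ (a :: v).length := by rw [List.length_cons, pow_succ]; ring

lemma exists_finset_superlist {x : ℝ} (hx : 0 < x) (hx1 : x ≤ 1) (n : ℕ) (s : List A) (k : ℕ) :
    ∃ E : Finset (List A), (∀ w : List A, w.length = n → s.Sublist w → n ≤ s.length + k → w ∈ E) ∧
      x ^ k * E.card ≤ (1 + Fintype.card A * x) ^ n := by
  induction n generalizing s k with
  | zero =>
    refine ⟨{[]}, fun w hw _ _ => by simpa using hw, ?_⟩
    simpa using pow_le_one₀ hx.le hx1
  | succ n ih =>
    set a : ℝ := ((Fintype.card A : ℕ) : ℝ) with ha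
    have ha0 : 0 ≤ a := by positivity
    obtain ⟨E, hE, hEc⟩ : ∃ E : Finset (List A), (∀ (b : A) (w t : List A), w.length = n →
        s = b :: t → t.Sublist w → n + 1 ≤ s.length + k → b :: w ∈ E) ∧
        x ^ k * E.card ≤ (1 + a * x) ^ n := by
      rcases s with _ | ⟨b, t⟩
      · exact ⟨∅, by simp, by simp; positivity⟩
      · obtain ⟨E, hE, hEc⟩ := ih t k
        refine ⟨E.image (List.cons b), ?_, ?_⟩
        · rintro b' w t' hw h ht hl
          obtain ⟨rfl, rfl⟩ := List.cons.inj h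
          exact Finset.mem_image_of_mem _ (hE w hw ht (by simp at hl; omega))
        · refine le_trans ?_ hEc
          refine mul_le_mul_of_nonneg_left ?_ (by positivity)
          exact_mod_cast Finset.card_image_le (f := List.cons b)
    have hcons : ∀ (b : A) (w : List A), (b :: w).length = n + 1 → s.Sublist (b :: w) →
        n + 1 ≤ s.length + k → s.Sublist w ∨ b :: w ∈ E := by
      intro b w hw hs hl
      rcases List.sublist_cons_iff.1 hs with h | ⟨t, rfl, ht⟩
      · exact .inl h
      · exact .inr (hE b w t (by simpa using hw) rfl ht hl)
    rcases k with _ | k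
    · refine ⟨E, fun w hw hs hl => ?_, ?_⟩
      · rcases w with _ | ⟨b, w⟩
        · simp at hw
        · refine (hcons b w hw hs hl).resolve_left fun h => ?_
          have := h.length_le
          simp at hw hl
          omega
      · refine hEc.trans ?_
        rw [pow_succ]
        have : 0 ≤ (1 + a * x) ^ n := by positivity
        nlinarith [mul_nonneg ha0 hx.le]
    · obtain ⟨E', hE', hEc'⟩ := ih s k
      refine ⟨(Finset.univ.biUnion fun b : A => E'.image (List.cons b)) ∪ E, fun w hw hs hl => ?_, ?_⟩
      · rcases w with _ | ⟨b, w⟩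
        · simp at hw
        · rw [Finset.mem_union]
          refine (hcons b w hw hs hl).imp_left fun h => ?_
          refine Finset.mem_biUnion.2 ⟨b, Finset.mem_univ _, Finset.mem_image_of_mem _
            (hE' w (by simpa using hw) h (by omega))⟩
      · have h1 : (Finset.univ.biUnion fun b : A => E'.image (List.cons b)).card ≤
            Fintype.card A * E'.card := by
          refine Finset.card_biUnion_le.trans ((Finset.sum_le_sum fun b _ =>
            Finset.card_image_le).trans ?_)
          simp
        have hu : (((Finset.univ.biUnion fun b : A => E'.image (List.cons b)) ∪ E).card : ℝ) ≤
            a * E'.card + E.card := by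
          rw [ha]
          exact_mod_cast (Finset.card_union_le _ _).trans (by gcongr)
        calc x ^ (k + 1) * _ ≤ x ^ (k + 1) * (a * E'.card + E.card) := by gcongr
          _ = a * x * (x ^ k * E'.card) + x ^ (k + 1) * E.card := by ring
          _ ≤ a * x * (1 + a * x) ^ n + (1 + a * x) ^ n := by gcongr
          _ = (1 + a * x) ^ (n + 1) := by rw [pow_succ]; ring

/-- Bound for the number of words of given length within a given edit distance of a word. -/
lemma exists_finset_editDist {x : ℝ} (hx : 0 < x) (hx1 : x ≤ 1) (v : List A) (m k : ℕ) :
    ∃ E : Finset (List A), (∀ w : List A, w.length = m → editDist v w ≤ k → w ∈ E) ∧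
      (E.card : ℝ) ≤ Real.exp (2 * k * (-Real.log x) + x * v.length + Fintype.card A * x * m) := by
  obtain ⟨D, hD, hDc⟩ := exists_finset_sublist hx hx1 v k
  choose E hE hEc using fun s : List A => exists_finset_superlist hx hx1 m s k
  refine ⟨D.biUnion E, fun w hw hd => ?_, ?_⟩
  · obtain ⟨s, h1, h2, h3, h4⟩ := (editPath_editDist v w).exists_sublist
    exact Finset.mem_biUnion.2 ⟨s, hD s h1 (by omega), hE s w hw h2 (by omega)⟩
  · set a : ℝ := ((Fintype.card A : ℕ) : ℝ) with ha
    have ha0 : 0 ≤ a := by positivity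
    have hxk : 0 < x ^ k := by positivity
    have h1 : ((D.biUnion E).card : ℝ) ≤ ∑ s ∈ D, ((E s).card : ℝ) := by
      exact_mod_cast Finset.card_biUnion_le
    have h2 : x ^ k * x ^ k * ((D.biUnion E).card : ℝ) ≤ (1 + x) ^ v.length * (1 + a * x) ^ m := by
      calc x ^ k * x ^ k * ((D.biUnion E).card : ℝ)
          ≤ x ^ k * x ^ k * ∑ s ∈ D, ((E s).card : ℝ) := by gcongr
        _ = x ^ k * ∑ s ∈ D, x ^ k * ((E s).card : ℝ) := by
            rw [Finset.mul_sum, Finset.mul_sum]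
            simp only [mul_assoc]
        _ ≤ x ^ k * ∑ s ∈ D, (1 + a * x) ^ m := by
            gcongr with s _
            exact hEc s
        _ = x ^ k * D.card * (1 + a * x) ^ m := by
            rw [Finset.sum_const, nsmul_eq_mul, mul_assoc]
        _ ≤ _ := by gcongr
    have h3 : (1 + x) ^ v.length ≤ Real.exp (x * v.length) := by
      rw [mul_comm, Real.exp_nat_mul]
      have := Real.add_one_le_exp x
      gcongr
      linarith
    have h4 : (1 + a * x) ^ m ≤ Real.exp (a * x * m) := by
      rw [mul_comm _ (m : ℝ), Real.exp_nat_mul]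
      have := Real.add_one_le_exp (a * x)
      gcongr
      linarith
    have h5 : Real.exp (2 * k * (-Real.log x)) = (x ^ k * x ^ k)⁻¹ := by
      rw [← pow_add, ← two_mul, ← Real.exp_log (x := x ^ (2 * k)) (by positivity), ← Real.exp_neg,
        Real.log_pow]
      push_cast
      ring_nf
    rw [Real.exp_add, Real.exp_add, h5, mul_assoc, ← div_eq_inv_mul, le_div_iff₀ (by positivity),
      mul_comm]
    exact h2.trans (mul_le_mul h3 h4 (by positivity) (by positivity))

lemma EditPath.length_le {n : ℕ} {v w : List A} (h : EditPath n v w) :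
    v.length ≤ w.length + n ∧ w.length ≤ v.length + n := by
  obtain ⟨s, h1, h2, h3, h4⟩ := h.exists_sublist
  have := h1.length_le
  have := h2.length_le
  omega

lemma AlmostAdditive.abs_sub_le_of_editStep {B : List A → ℝ} {C : ℝ} (hB : AlmostAdditive B C)
    {v w : List A} (h : EditStep v w) : |B v - B w| ≤ 6 * C := by
  have hC := hB.nonneg
  have key : ∀ (u₁ u₂ : List A) (a : A), |B (u₁ ++ [a] ++ u₂) - (B u₁ + B u₂)| ≤ 3 * C := by
    intro u₁ u₂ a
    have h1 := abs_le.1 (hB.append (u₁ ++ [a]) u₂)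
    have h2 := abs_le.1 (hB.append u₁ [a])
    have h3 := abs_le.1 (hB.singleton a)
    rw [abs_le]
    constructor <;> linarith [h1.1, h1.2, h2.1, h2.2, h3.1, h3.2]
  rcases h with ⟨u₁, u₂, a, a', rfl, rfl⟩ | ⟨u₁, u₂, a', rfl, rfl⟩ | ⟨u₁, u₂, a, rfl, rfl⟩
  · have h1 := abs_le.1 (key u₁ u₂ a)
    have h2 := abs_le.1 (key u₁ u₂ a')
    rw [abs_le]
    constructor <;> linarith [h1.1, h1.2, h2.1, h2.2]
  · have h1 := abs_le.1 (key u₁ u₂ a')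
    have h2 := abs_le.1 (hB.append u₁ u₂)
    rw [abs_le]
    constructor <;> linarith [h1.1, h1.2, h2.1, h2.2]
  · have h1 := abs_le.1 (key u₁ u₂ a)
    have h2 := abs_le.1 (hB.append u₁ u₂)
    rw [abs_le]
    constructor <;> linarith [h1.1, h1.2, h2.1, h2.2]

lemma AlmostAdditive.abs_sub_le_of_editPath {B : List A → ℝ} {C : ℝ} (hB : AlmostAdditive B C)
    {n : ℕ} {v w : List A} (h : EditPath n v w) : |B v - B w| ≤ 6 * C * n := by
  induction h with
  | refl v => simp
  | @step n v w w' _ hs ih =>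
    have h1 := hB.abs_sub_le_of_editStep hs
    have h2 := abs_sub_le (B v) (B w) (B w')
    push_cast
    linarith

lemma AlmostAdditive.abs_le_length {B : List A → ℝ} {C : ℝ} (hB : AlmostAdditive B C)
    (v : List A) : |B v| ≤ C * (1 + 2 * v.length) := by
  induction v with
  | nil =>
    have := hB.append [] []
    simpa using this
  | cons a v ih =>
    have h1 := abs_le.1 (hB.append [a] v)
    have h2 := abs_le.1 (hB.singleton a)
    have h3 := abs_le.1 ih
    have e : a :: v = [a] ++ v := rfl
    rw [e, abs_le]
    simp only [List.length_append, List.length_singleton]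
    push_cast
    constructor <;> nlinarith [h1.1, h1.2, h2.1, h2.2, h3.1, h3.2]

end Edit

/-! ### Typical sequences for finite distributions -/

section Typical

variable {Ω : Type*} [Fintype Ω]

lemma sum_finCons {N : ℕ} (g : (Fin (N + 1) → Ω) → ℝ) :
    ∑ w, g w = ∑ a : Ω, ∑ w : Fin N → Ω, g (Fin.cons a w) := by
  rw [← (Fin.consEquiv fun _ : Fin (N + 1) => Ω).sum_comp, Fintype.sum_prod_type]
  rfl

lemma sum_prod_weight {p : Ω → ℝ} (hp : ∑ a, p a = 1) (N : ℕ) :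
    ∑ w : Fin N → Ω, ∏ j, p (w j) = 1 := by
  induction N with
  | zero => simp
  | succ N ih =>
    rw [sum_finCons]
    simp only [Fin.prod_univ_succ, Fin.cons_zero, Fin.cons_succ, ← Finset.mul_sum, ih, mul_one, hp]

lemma sum_prod_weight_mul {p F : Ω → ℝ} (hp : ∑ a, p a = 1) (hF : ∑ a, p a * F a = 0) (N : ℕ) :
    ∑ w : Fin N → Ω, (∏ j, p (w j)) * ∑ j, F (w j) = 0 := by
  induction N with
  | zero => simp
  | succ N ih =>
    rw [sum_finCons]
    simp only [Fin.prod_univ_succ, Fin.sum_univ_succ, Fin.cons_zero, Fin.cons_succ]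
    have : ∀ (a : Ω), ∑ w : Fin N → Ω, p a * (∏ j, p (w j)) * (F a + ∑ j, F (w j)) =
        p a * F a := by
      intro a
      have e : ∀ w : Fin N → Ω, p a * (∏ j, p (w j)) * (F a + ∑ j, F (w j)) =
          p a * F a * (∏ j, p (w j)) + p a * ((∏ j, p (w j)) * ∑ j, F (w j)) := fun w => by ring
      simp only [e, Finset.sum_add_distrib, ← Finset.mul_sum, ih, sum_prod_weight hp]
      ring
    simp only [this, hF]

lemma sum_prod_weight_mul_sq {p F : Ω → ℝ} (hp : ∑ a, p a = 1) (hF : ∑ a, p a * F a = 0) (N : ℕ) :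
    ∑ w : Fin N → Ω, (∏ j, p (w j)) * (∑ j, F (w j)) ^ 2 = N * ∑ a, p a * F a ^ 2 := by
  induction N with
  | zero => simp
  | succ N ih =>
    rw [sum_finCons]
    simp only [Fin.prod_univ_succ, Fin.sum_univ_succ, Fin.cons_zero, Fin.cons_succ]
    have : ∀ (a : Ω), ∑ w : Fin N → Ω, p a * (∏ j, p (w j)) * (F a + ∑ j, F (w j)) ^ 2 =
        p a * F a ^ 2 + p a * (N * ∑ a, p a * F a ^ 2) := by
      intro a
      have e : ∀ w : Fin N → Ω, p a * (∏ j, p (w j)) * (F a + ∑ j, F (w j)) ^ 2 =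
          p a * F a ^ 2 * (∏ j, p (w j)) + 2 * p a * F a * ((∏ j, p (w j)) * ∑ j, F (w j)) +
          p a * ((∏ j, p (w j)) * (∑ j, F (w j)) ^ 2) := fun w => by ring
      simp only [e, Finset.sum_add_distrib, ← Finset.mul_sum, ih, sum_prod_weight hp,
        sum_prod_weight_mul hp hF]
      ring
    simp only [this, Finset.sum_add_distrib, ← Finset.sum_mul, hp]
    push_cast
    ring

/-- Chebyshev's inequality for i.i.d. sums with finite distribution. -/
lemma sum_weight_deviation_le {p : Ω → ℝ} (hp0 : ∀ a, 0 ≤ p a) (hp : ∑ a, p a = 1)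
    (F : Ω → ℝ) {c : ℝ} (hc : 0 < c) :
    ∃ N₀ : ℕ, ∀ N, N₀ ≤ N → ∀ {δ : ℝ}, c ≤ δ →
      ∑ w : Fin N → Ω with N * δ < |∑ j, F (w j) - N * ∑ a, p a * F a|, ∏ j, p (w j) ≤ c := by
  set E := ∑ a, p a * F a with hE
  set V := ∑ a, p a * (F a - E) ^ 2 with hV
  have hV0 : 0 ≤ V := Finset.sum_nonneg fun a _ => mul_nonneg (hp0 a) (sq_nonneg _)
  have hF : ∑ a, p a * (F a - E) = 0 := by
    simp only [mul_sub, Finset.sum_sub_distrib, ← Finset.sum_mul, hp]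
    rw [hE]; ring
  obtain ⟨N₀, hN₀⟩ := exists_nat_gt (V / c ^ 3)
  refine ⟨N₀, fun N hN δ hδ => ?_⟩
  have hN0 : (0 : ℝ) < N := by
    have : (0 : ℝ) ≤ V / c ^ 3 := by positivity
    have : (N₀ : ℝ) ≤ N := by exact_mod_cast hN
    linarith
  have hNV : V < N * c ^ 3 := by
    have h2 : (N₀ : ℝ) ≤ N := by exact_mod_cast hN
    rw [← div_lt_iff₀ (by positivity)]
    linarith
  have key : (N * c) ^ 2 * ∑ w : Fin N → Ω with N * δ < |∑ j, F (w j) - N * E|, ∏ j, p (w j) ≤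
      N * V := by
    rw [hV, ← sum_prod_weight_mul_sq hp hF N, Finset.mul_sum, Finset.sum_filter]
    refine Finset.sum_le_sum fun w _ => ?_
    have hw : 0 ≤ ∏ j, p (w j) := Finset.prod_nonneg fun j _ => hp0 _
    have e : ∑ j, (F (w j) - E) = ∑ j, F (w j) - N * E := by
      rw [Finset.sum_sub_distrib]; simp
    rw [e]
    split_ifs with h
    · rw [mul_comm, ← sq_abs (∑ j, F (w j) - N * E)]
      have : N * c ≤ |∑ j, F (w j) - N * E| := le_trans (by gcongr) h.le
      gcongr
    · positivity
  have h3 : (N * c) ^ 2 * c = N * (N * c ^ 3) := by ring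
  have h4 : N * V ≤ (N * c) ^ 2 * c := by rw [h3]; gcongr
  exact le_of_mul_le_mul_left (key.trans h4) (by positivity)

lemma exists_typical {p : Ω → ℝ} (hp0 : ∀ a, 0 ≤ p a) (hp : ∑ a, p a = 1) {ι : Type*} [Fintype ι]
    (F : ι → Ω → ℝ) {δ : ℝ} (hδ : 0 < δ) :
    ∃ N₀ : ℕ, ∀ N, N₀ ≤ N → ∃ T : Finset (Fin N → Ω),
      (∀ w ∈ T, (∀ j, 0 < p (w j)) ∧ ∀ i, |∑ j, F i (w j) - N * ∑ a, p a * F i a| ≤ N * δ) ∧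
      1 / 2 * Real.exp (N * (∑ a, Real.negMulLog (p a) - δ)) ≤ T.card := by
  set F' : Option ι → Ω → ℝ := fun i => i.elim (fun a => -Real.log (p a)) F with hF'
  set M : ℝ := ((Fintype.card (Option ι) : ℕ) : ℝ) with hM
  have hM1 : 1 ≤ M := by rw [hM]; exact_mod_cast Fintype.card_pos
  set c : ℝ := min δ (1 / (2 * M)) with hc
  have hc0 : 0 < c := lt_min hδ (by positivity)
  have hcM : M * c ≤ 1 / 2 := by
    have : c ≤ 1 / (2 * M) := min_le_right _ _
    rw [le_div_iff₀ (by positivity)] at this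
    linarith
  choose N₀ hN₀ using fun i => sum_weight_deviation_le hp0 hp (F' i) hc0
  refine ⟨∑ i, N₀ i, fun N hN => ?_⟩
  set W : (Fin N → Ω) → ℝ := fun w => ∏ j, p (w j) with hW
  have hW0 : ∀ w, 0 ≤ W w := fun w => Finset.prod_nonneg fun j _ => hp0 _
  set bad : Option ι → Finset (Fin N → Ω) := fun i =>
    Finset.univ.filter fun w => N * δ < |∑ j, F' i (w j) - N * ∑ a, p a * F' i a| with hbad
  have hbadc : ∀ i, ∑ w ∈ bad i, W w ≤ c := fun i =>
    hN₀ i N ((Finset.single_le_sum (f := N₀) (fun _ _ => Nat.zero_le _)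
      (Finset.mem_univ i)).trans hN) (min_le_left _ _)
  set T : Finset (Fin N → Ω) := Finset.univ.filter fun w => (∀ j, 0 < p (w j)) ∧
    ∀ i, w ∉ bad i with hT
  have hsum : (1 : ℝ) ≤ ∑ w ∈ T, W w + ∑ i, ∑ w ∈ bad i, W w := by
    rw [← sum_prod_weight hp N]
    have h1 : ∀ w : Fin N → Ω, W w ≤ (if w ∈ T then W w else 0) +
        ∑ i, if w ∈ bad i then W w else 0 := by
      intro w
      have hnn : ∀ i ∈ Finset.univ, 0 ≤ if w ∈ bad i then W w else 0 := by
        intro i _; split_ifs <;> simp [hW0]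
      by_cases hb : ∃ i, w ∈ bad i
      · obtain ⟨i, hi⟩ := hb
        have := Finset.single_le_sum hnn (Finset.mem_univ i)
        rw [if_pos hi] at this
        have h2 : 0 ≤ if w ∈ T then W w else 0 := by split_ifs <;> simp [hW0]
        linarith
      · have h3 := Finset.sum_nonneg hnn
        by_cases hpos : ∀ j, 0 < p (w j)
        · have : w ∈ T := by
            rw [hT, Finset.mem_filter]
            exact ⟨Finset.mem_univ _, hpos, not_exists.1 hb⟩
          rw [if_pos this]
          linarith
        · push Not at hpos
          obtain ⟨j, hj⟩ := hpos
          have : W w = 0 := Finset.prod_eq_zero (Finset.mem_univ j) (le_antisymm hj (hp0 _))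
          rw [this]; simp
    refine (Finset.sum_le_sum fun w _ => h1 w).trans (le_of_eq ?_)
    rw [Finset.sum_add_distrib, Finset.sum_comm]
    simp only [Finset.sum_ite_mem, Finset.univ_inter]
  have hsumbad : ∑ i, ∑ w ∈ bad i, W w ≤ 1 / 2 := by
    refine (Finset.sum_le_sum fun i _ => hbadc i).trans ?_
    rw [Finset.sum_const, nsmul_eq_mul]
    exact hcM
  refine ⟨T, fun w hw => ?_, ?_⟩
  · rw [hT, Finset.mem_filter] at hw
    refine ⟨hw.2.1, fun i => ?_⟩
    have := hw.2.2 (some i)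
    rw [hbad, Finset.mem_filter] at this
    simpa [hF'] using this
  · set H := ∑ a, Real.negMulLog (p a) with hH
    have hWT : ∀ w ∈ T, W w ≤ Real.exp (-(N * (H - δ))) := by
      intro w hw
      rw [hT, Finset.mem_filter] at hw
      have hw2 := hw.2.2 none
      rw [hbad, Finset.mem_filter] at hw2
      simp only [Finset.mem_univ, true_and, not_lt, hF', Option.elim] at hw2
      have e : ∑ a, p a * -Real.log (p a) = H := by
        rw [hH]; exact Finset.sum_congr rfl fun a _ => by rw [Real.negMulLog]; ring
      rw [e] at hw2
      have e2 : W w = Real.exp (-∑ j, -Real.log (p (w j))) := by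
        rw [← Finset.sum_neg_distrib, Real.exp_sum, hW]
        refine Finset.prod_congr rfl fun j _ => ?_
        rw [neg_neg, Real.exp_log (hw.2.1 j)]
      rw [e2, Real.exp_le_exp]
      have := (abs_le.1 hw2).1
      linarith
    have h1 : ∑ w ∈ T, W w ≤ T.card * Real.exp (-(N * (H - δ))) := by
      refine (Finset.sum_le_sum hWT).trans (le_of_eq ?_)
      rw [Finset.sum_const, nsmul_eq_mul]
    have h2 : 1 / 2 ≤ T.card * Real.exp (-(N * (H - δ))) := by linarith
    rw [Real.exp_neg, ← div_eq_mul_inv, le_div_iff₀ (Real.exp_pos _)] at h2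
    exact h2

end Typical

/-! ### Gluing words -/

section Glue

/-- Concatenation of a sequence of words with gap words prescribed by `u`. -/
def glue (u : List A → List A → List A) (γ : ℕ → List A) : ℕ → List A
  | 0 => γ 0
  | j + 1 => glue u γ j ++ u (glue u γ j) (γ (j + 1)) ++ γ (j + 1)

/-- The gap word inserted in the `j`-th step of the concatenation. -/
def gap (u : List A → List A → List A) (γ : ℕ → List A) (j : ℕ) : List A :=
  u (glue u γ j) (γ (j + 1))

variable {u : List A → List A → List A} {γ γ' : ℕ → List A}

lemma glue_succ (j : ℕ) : glue u γ (j + 1) = glue u γ j ++ gap u γ j ++ γ (j + 1) := rfl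

lemma glue_prefix {i j : ℕ} (h : i ≤ j) : glue u γ i <+: glue u γ j := by
  induction h with
  | refl => exact List.prefix_refl _
  | step _ ih =>
    refine ih.trans ?_
    rw [Nat.succ_eq_add_one, glue_succ, List.append_assoc]
    exact List.prefix_append _ _

lemma length_glue (J : ℕ) : (glue u γ J).length =
    ∑ j ∈ Finset.range (J + 1), (γ j).length + ∑ j ∈ Finset.range J, (gap u γ j).length := by
  induction J with
  | zero => simp [glue]
  | succ J ih =>
    rw [glue_succ, List.length_append, List.length_append, ih, Finset.sum_range_succ _ (J + 1),
      Finset.sum_range_succ (fun j => (gap u γ j).length) J]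
    omega

/-- The words of a concatenation are determined by the concatenation and the lengths. -/
lemma glue_injective {J : ℕ} {w : List A} (h : ∀ j ≤ J, (γ j).length = (γ' j).length)
    (hg : ∀ j < J, (gap u γ j).length = (gap u γ' j).length)
    (hw : glue u γ J <+: w) (hw' : glue u γ' J <+: w) : ∀ j ≤ J, γ j = γ' j := by
  have hlen : ∀ j ≤ J, (glue u γ j).length = (glue u γ' j).length := by
    intro j hj
    rw [length_glue, length_glue]
    congr 1
    · exact Finset.sum_congr rfl fun i hi => h i (by rw [Finset.mem_range] at hi; omega)
    · exact Finset.sum_congr rfl fun i hi => hg i (by rw [Finset.mem_range] at hi; omega)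
  have heq : ∀ j ≤ J, glue u γ j = glue u γ' j := by
    intro j hj
    exact List.IsPrefix.eq_of_length
      (List.prefix_of_prefix_length_le ((glue_prefix hj).trans hw) ((glue_prefix hj).trans hw')
        (hlen j hj).le) (hlen j hj)
  intro j hj
  rcases j with _ | j
  · exact heq 0 hj
  · have := heq (j + 1) hj
    rw [glue_succ, glue_succ] at this
    exact (List.append_inj_right' this (h _ hj))

end Glue

/-! ### Words with prescribed statistics -/

section Words

variable {X : Set (ℕ → A)}

lemma prefixWord_eq_ofFn (x : ℕ → A) (n : ℕ) : prefixWord x n = List.ofFn (initial n x) := rfl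

lemma exists_of_cylMass_pos {μ : ProbabilityMeasure X} {m : ℕ} {w : Fin m → A}
    (h : 0 < cylMass μ w) : List.ofFn w ∈ language X := by
  have : (Subtype.val ⁻¹' cylF w : Set X).Nonempty := by
    by_contra hn
    rw [not_nonempty_iff_eq_empty] at hn
    rw [cylMass, hn] at h
    simp at h
  obtain ⟨x, hx⟩ := this
  rw [mem_language_iff]
  refine ⟨x, ?_⟩
  rw [List.length_ofFn, prefixWord_eq_ofFn, mem_cylF_iff.1 hx]

lemma integral_birkhoff (hXcl : IsClosed X) (hXinv : Set.MapsTo shift X X)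
    {μ : ProbabilityMeasure X} (hμ : IsInvariant (subShift X) μ) {f : X → ℝ} (hf : Continuous f)
    (n : ℕ) : ∫ x, birkhoff (subShift X) f n x ∂μ.toMeasure = n * ∫ x, f x ∂μ.toMeasure := by
  have hcont : ∀ i, Continuous fun x => f ((subShift X)^[i] x) := fun i =>
    hf.comp ((continuous_subShift hXinv).iterate i)
  have h1 : ∀ i, ∫ x, f ((subShift X)^[i] x) ∂μ.toMeasure = ∫ x, f x ∂μ.toMeasure := by
    intro i
    induction i with
    | zero => rfl
    | succ i ih =>
      rw [← ih]
      exact hμ.integral_comp hXinv (hcont i)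
  simp only [birkhoff]
  rw [integral_finsetSum _ fun i _ => integrable_of_continuous hXcl μ (hcont i)]
  simp [h1]

lemma abs_sum_cylMass_mul_le (hXcl : IsClosed X) (hXinv : Set.MapsTo shift X X)
    {μ : ProbabilityMeasure X} (hμ : IsInvariant (subShift X) μ) {f : X → ℝ} (hf : Continuous f)
    (hf0 : ∫ x, f x ∂μ.toMeasure = 0) {B : List A → ℝ} {m : ℕ} {c : ℝ}
    (hB : ∀ x : X, |birkhoff (subShift X) f m x - B (prefixWord x.1 m)| ≤ c) :
    |∑ w : Fin m → A, cylMass μ w * B (List.ofFn w)| ≤ c := by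
  have hcB : Continuous fun x : X => B (prefixWord x.1 m) :=
    (continuous_of_discreteTopology (f := fun w : Fin m → A => B (List.ofFn w))).comp
      (continuous_initial m)
  have hcf : Continuous (birkhoff (subShift X) f m) := continuous_finsetSum _ fun i _ =>
    hf.comp ((continuous_subShift hXinv).iterate i)
  have h0 := integral_birkhoff hXcl hXinv hμ hf m
  rw [hf0, mul_zero] at h0
  rw [← integral_initial μ fun w => B (List.ofFn w)]
  have h1 : ∫ x : X, B (List.ofFn (initial m x.1)) ∂μ.toMeasure =
      ∫ x : X, (B (prefixWord x.1 m) - birkhoff (subShift X) f m x) ∂μ.toMeasure := by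
    rw [integral_sub (integrable_of_continuous hXcl μ hcB) (integrable_of_continuous hXcl μ hcf),
      h0, sub_zero]
    rfl
  rw [h1, ← Real.norm_eq_abs]
  refine (norm_integral_le_of_norm_le_const (C := c) (Eventually.of_forall fun x => ?_)).trans
    (by simp)
  rw [Real.norm_eq_abs, abs_sub_comm]
  exact hB x

variable {G : Set (List A)} {τ : ℕ} {u : List A → List A → List A}

lemma glue_mem (hu : ∀ v ∈ G, ∀ w ∈ G, (u v w).length ≤ τ ∧ v ++ u v w ++ w ∈ G)
    {γ : ℕ → List A} {J : ℕ} (hγ : ∀ j ≤ J, γ j ∈ G) : glue u γ J ∈ G := by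
  induction J with
  | zero => exact hγ 0 le_rfl
  | succ J ih => exact (hu _ (ih fun j hj => hγ j (by omega)) _ (hγ (J + 1) le_rfl)).2

lemma length_gap_le (hu : ∀ v ∈ G, ∀ w ∈ G, (u v w).length ≤ τ ∧ v ++ u v w ++ w ∈ G)
    {γ : ℕ → List A} {j : ℕ} (hγ : ∀ i ≤ j + 1, γ i ∈ G) : (gap u γ j).length ≤ τ :=
  (hu _ (glue_mem hu fun i hi => hγ i (by omega)) _ (hγ (j + 1) le_rfl)).1

lemma AlmostAdditive.abs_glue_sub_le {B : List A → ℝ} {C : ℝ} (hB : AlmostAdditive B C)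
    {γ : ℕ → List A} {J : ℕ} (hgap : ∀ j < J, (gap u γ j).length ≤ τ) :
    |B (glue u γ J) - ∑ j ∈ Finset.range (J + 1), B (γ j)| ≤ J * (C * (3 + 2 * τ)) := by
  induction J with
  | zero => simp [glue]
  | succ J ih =>
    have h0 := ih fun j hj => hgap j (by omega)
    have h1 := hB.append (glue u γ J ++ gap u γ J) (γ (J + 1))
    have h2 := hB.append (glue u γ J) (gap u γ J)
    have h3 : |B (gap u γ J)| ≤ C * (1 + 2 * τ) := by
      refine (hB.abs_le_length _).trans ?_
      have := hB.nonneg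
      have : ((gap u γ J).length : ℝ) ≤ τ := by exact_mod_cast hgap J (by omega)
      gcongr
    rw [glue_succ, Finset.sum_range_succ]
    rw [abs_le] at *
    push_cast
    constructor <;> linarith [h0.1, h0.2, h1.1, h1.2, h2.1, h2.2, h3.1, h3.2]

/-- Gluing together edited words: the number of words obtained. -/
lemma exists_glued_words
    (hu : ∀ v ∈ G, ∀ w ∈ G, (u v w).length ≤ τ ∧ v ++ u v w ++ w ∈ G)
    {m k K : ℕ} {e : List A → List A}
    (heG : ∀ w ∈ language X, w.length = m → e w ∈ G ∧ editDist (e w) w ≤ k)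
    (hK : ∀ v : List A, v.length ≤ m + k → ∃ E : Finset (List A),
      (∀ w : List A, w.length = m → editDist v w ≤ k → w ∈ E) ∧ E.card ≤ K)
    {J : ℕ} {T : Finset (Fin (J + 1) → Fin m → A)}
    (hT : ∀ w ∈ T, ∀ j, List.ofFn (w j) ∈ language X) (hTne : T.Nonempty) :
    ∃ (n : ℕ) (Γ : Finset (List A)), (J + 1) * m ≤ n + (J + 1) * k ∧ n ≤ (J + 1) * (m + k + τ) ∧
      (∀ V ∈ Γ, V ∈ G ∧ V.length = n ∧ ∃ w ∈ T, ∃ γ : ℕ → List A,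
        (∀ j : Fin (J + 1), γ j = e (List.ofFn (w j))) ∧ (∀ j < J, (gap u γ j).length ≤ τ) ∧
        V = glue u γ J) ∧
      T.card ≤ Γ.card * ((J + 1) * (m + k + τ) + 1) * ((m + k + 1) * (τ + 1) * K) ^ (J + 1) := by
  set γ : (Fin (J + 1) → Fin m → A) → ℕ → List A := fun w j =>
    if h : j < J + 1 then e (List.ofFn (w ⟨j, h⟩)) else [] with hγ
  have hγe : ∀ w (j : Fin (J + 1)), γ w j = e (List.ofFn (w j)) := by
    intro w j; simp only [hγ, dif_pos j.2]
  have hγG : ∀ w ∈ T, ∀ j ≤ J, γ w j ∈ G := by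
    intro w hw j hj
    rw [show j = ((⟨j, by omega⟩ : Fin (J + 1)) : ℕ) from rfl, hγe]
    exact (heG _ (hT w hw _) (by simp)).1
  have hdist : ∀ w ∈ T, ∀ j : Fin (J + 1), editDist (γ w j) (List.ofFn (w j)) ≤ k := by
    intro w hw j
    rw [hγe]
    exact (heG _ (hT w hw _) (by simp)).2
  have hlen : ∀ w ∈ T, ∀ j ≤ J, (γ w j).length ≤ m + k ∧ m ≤ (γ w j).length + k := by
    intro w hw j hj
    have h1 := hdist w hw ⟨j, by omega⟩
    have h2 := (editPath_editDist (γ w j) (List.ofFn (w ⟨j, by omega⟩))).length_le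
    simp only [List.length_ofFn] at h2
    simp only at h1
    omega
  have hgap : ∀ w ∈ T, ∀ j < J, (gap u (γ w) j).length ≤ τ := fun w hw j hj =>
    length_gap_le hu fun i hi => hγG w hw i (by omega)
  set Φ : (Fin (J + 1) → Fin m → A) → List A := fun w => glue u (γ w) J with hΦ
  have hΦlen : ∀ w ∈ T, (J + 1) * m ≤ (Φ w).length + (J + 1) * k ∧
      (Φ w).length ≤ (J + 1) * (m + k + τ) := by
    intro w hw
    rw [hΦ]
    simp only [length_glue]
    have h1 : ∑ j ∈ Finset.range (J + 1), (γ w j).length ≤ (J + 1) * (m + k) := by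
      have := Finset.sum_le_card_nsmul (Finset.range (J + 1)) (fun j => (γ w j).length) (m + k)
        fun j hj => (hlen w hw j (by rw [Finset.mem_range] at hj; omega)).1
      simpa using this
    have h2 : (J + 1) * m ≤ ∑ j ∈ Finset.range (J + 1), (γ w j).length + (J + 1) * k := by
      have := Finset.card_nsmul_le_sum (Finset.range (J + 1)) (fun j => (γ w j).length + k) m
        fun j hj => (hlen w hw j (by rw [Finset.mem_range] at hj; omega)).2
      simpa [Finset.sum_add_distrib] using this
    have h3 : ∑ j ∈ Finset.range J, (gap u (γ w) j).length ≤ J * τ := by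
      have := Finset.sum_le_card_nsmul (Finset.range J) (fun j => (gap u (γ w) j).length) τ
        fun j hj => hgap w hw j (by simpa using hj)
      simpa using this
    constructor
    · omega
    · nlinarith
  -- the fibres of the gluing map
  set κ : (Fin (J + 1) → Fin m → A) →
      List A × (Fin (J + 1) → Fin (m + k + 1)) × (Fin (J + 1) → Fin (τ + 1)) := fun w =>
    (Φ w, fun j => Fin.ofNat _ (γ w j).length, fun j => Fin.ofNat _ (gap u (γ w) j).length) with hκ
  have hfib : ∀ b ∈ T.image κ, (T.filter fun w => κ w = b).card ≤ K ^ (J + 1) := by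
    intro b hb
    obtain ⟨w₀, hw₀, rfl⟩ := Finset.mem_image.1 hb
    have hcase : ∀ j : Fin (J + 1), ∃ E : Finset (List A),
      (∀ w : List A, w.length = m → editDist (γ w₀ j) w ≤ k → w ∈ E) ∧ E.card ≤ K := fun j =>
        hK _ (hlen w₀ hw₀ j (by omega)).1
    choose E hE hEK using hcase
    have h1 : (T.filter fun w => κ w = κ w₀).card ≤ (Fintype.piFinset E).card := by
      refine Finset.card_le_card_of_injOn (fun w j => List.ofFn (w j)) ?_ ?_
      · intro w hw
        rw [Finset.mem_coe, Finset.mem_filter] at hw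
        obtain ⟨hw, hκw⟩ := hw
        simp only [hκ, Prod.mk.injEq] at hκw
        obtain ⟨h1, h2, h3⟩ := hκw
        have heq := glue_injective (u := u) (γ := γ w) (γ' := γ w₀) (J := J) (w := Φ w) (by
          intro j hj
          have := congrArg Fin.val (congrFun h2 ⟨j, by omega⟩)
          simp only [Fin.val_ofNat] at this
          rwa [Nat.mod_eq_of_lt (by have := (hlen w hw j hj).1; omega),
            Nat.mod_eq_of_lt (by have := (hlen w₀ hw₀ j hj).1; omega)] at this) (by
          intro j hj
          have := congrArg Fin.val (congrFun h3 ⟨j, by omega⟩)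
          simp only [Fin.val_ofNat] at this
          rwa [Nat.mod_eq_of_lt (by have := hgap w hw j hj; omega),
            Nat.mod_eq_of_lt (by have := hgap w₀ hw₀ j hj; omega)] at this)
          (List.prefix_refl _) (by rw [h1])
        rw [Finset.mem_coe, Fintype.mem_piFinset]
        intro j
        refine hE j _ (by simp) ?_
        rw [← heq j (by omega)]
        exact hdist w hw j
      · intro w _ w' _ h
        funext j
        exact List.ofFn_injective (congrFun h j)
    refine h1.trans ?_
    rw [Fintype.card_piFinset]
    refine (Finset.prod_le_prod' fun j _ => hEK j).trans ?_
    simp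
  have hcount : T.card ≤ K ^ (J + 1) * ((T.image Φ).card * ((m + k + 1) ^ (J + 1) *
      (τ + 1) ^ (J + 1))) := by
    refine (Finset.card_le_mul_card_image T _ hfib).trans ?_
    refine Nat.mul_le_mul_left _ ?_
    have : T.image κ ⊆ (T.image Φ) ×ˢ (Finset.univ ×ˢ Finset.univ) := by
      intro b hb
      obtain ⟨w, hw, rfl⟩ := Finset.mem_image.1 hb
      simp only [Finset.mem_product, Finset.mem_univ, and_true]
      exact Finset.mem_image_of_mem _ hw
    refine (Finset.card_le_card this).trans ?_
    simp [Finset.card_product]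
  obtain ⟨n, hn, hmax⟩ := Finset.exists_max_image ((T.image Φ).image List.length)
    (fun n => ((T.image Φ).filter fun V => V.length = n).card) ((hTne.image _).image _)
  have hpig : (T.image Φ).card ≤ ((J + 1) * (m + k + τ) + 1) *
      ((T.image Φ).filter fun V => V.length = n).card := by
    rw [Finset.card_eq_sum_card_image List.length (T.image Φ)]
    refine (Finset.sum_le_card_nsmul _ _ _ hmax).trans ?_
    rw [smul_eq_mul]
    refine Nat.mul_le_mul_right _ ?_
    have : (T.image Φ).image List.length ⊆ Finset.range ((J + 1) * (m + k + τ) + 1) := by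
      intro l hl
      obtain ⟨V, hV, rfl⟩ := Finset.mem_image.1 hl
      obtain ⟨w, hw, rfl⟩ := Finset.mem_image.1 hV
      rw [Finset.mem_range]
      have := (hΦlen w hw).2
      omega
    simpa using Finset.card_le_card this
  obtain ⟨V₀, hV₀, rfl⟩ := Finset.mem_image.1 hn
  obtain ⟨w₀, hw₀, rfl⟩ := Finset.mem_image.1 hV₀
  refine ⟨(Φ w₀).length, (T.image Φ).filter fun V => V.length = (Φ w₀).length, (hΦlen w₀ hw₀).1,
    (hΦlen w₀ hw₀).2, fun V hV => ?_, ?_⟩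
  · obtain ⟨hV, hVn⟩ := Finset.mem_filter.1 hV
    obtain ⟨w, hw, rfl⟩ := Finset.mem_image.1 hV
    exact ⟨glue_mem hu (hγG w hw), hVn, w, hw, γ w, hγe w, hgap w hw, rfl⟩
  · refine (hcount.trans (Nat.mul_le_mul_left _ (Nat.mul_le_mul_right _ hpig))).trans (le_of_eq ?_)
    rw [mul_pow, mul_pow]
    ring

end Words

/-! ### Many words of the same length with small Birkhoff sums -/

section ManyWords

lemma MistakeFun.eventually_le {g : ℕ → ℕ} (hg : MistakeFun g) {ρ : ℝ} (hρ : 0 < ρ) :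
    ∀ᶠ m : ℕ in atTop, (g m : ℝ) ≤ ρ * m := by
  filter_upwards [hg.2.eventually (gt_mem_nhds hρ), eventually_gt_atTop 0] with m hm hm0
  have : (0 : ℝ) < m := by exact_mod_cast hm0
  rw [div_lt_iff₀ this] at hm
  exact hm.le

lemma eventually_linear_le_exp {a b c : ℝ} (hc : 0 < c) :
    ∀ᶠ m : ℕ in atTop, a * m + b ≤ Real.exp (c * m) := by
  have h1 : Tendsto (fun m : ℕ => c * (m : ℝ)) atTop atTop :=
    tendsto_natCast_atTop_atTop.const_mul_atTop hc
  have h2 := (Real.tendsto_exp_div_pow_atTop 1).comp h1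
  filter_upwards [h2.eventually_ge_atTop (|a| / c + |b|), h1.eventually_ge_atTop 1] with m hm hm1
  simp only [Function.comp, pow_one] at hm
  rw [le_div_iff₀ (by linarith)] at hm
  have h3 : |a| / c * (c * m) = |a| * m := by field_simp
  have h4 : |b| ≤ |b| * (c * m) := by nlinarith [abs_nonneg b]
  have h5 : a * m ≤ |a| * m := mul_le_mul_of_nonneg_right (le_abs_self a) (Nat.cast_nonneg m)
  nlinarith [le_abs_self b]

lemma eventually_const_le {c b : ℝ} (hc : 0 < c) : ∀ᶠ m : ℕ in atTop, b ≤ c * m :=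
  (tendsto_natCast_atTop_atTop.const_mul_atTop hc).eventually_ge_atTop b

lemma exists_edit_parameters {g : ℕ → ℕ} (hg : MistakeFun g) (τ : ℕ)
    {h C η : ℝ} (hh : 0 ≤ h) (hC : 0 ≤ C) (hη : 0 < η) :
    ∃ m K : ℕ, 1 ≤ m ∧ 2 * g m ≤ m ∧
      (∀ v : List A, v.length ≤ m + g m → ∃ E : Finset (List A),
        (∀ w : List A, w.length = m → editDist v w ≤ g m → w ∈ E) ∧ E.card ≤ K) ∧
      ((m : ℝ) + g m + 1) * (τ + 1) * K ≤ Real.exp (η * m / 4) ∧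
      h * (g m + τ) + 1 ≤ η * m / 8 ∧
      6 * C * g m + C * (5 + 2 * τ) + 1 ≤ η * m / 8 := by
  set a : ℝ := ((Fintype.card A : ℕ) : ℝ) with ha
  have ha0 : 0 ≤ a := Nat.cast_nonneg _
  set x : ℝ := min 1 (η / (16 * (2 + a))) with hx
  have hx0 : 0 < x := lt_min one_pos (by positivity)
  have hx1 : x ≤ 1 := min_le_left _ _
  have hxa : x * (2 + a) ≤ η / 16 := by
    have : x ≤ η / (16 * (2 + a)) := min_le_right _ _
    rw [le_div_iff₀ (by positivity)] at this
    linarith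
  have hlx : 0 ≤ -Real.log x := by have := Real.log_nonpos hx0.le hx1; linarith
  set Q : ℝ := 2 + 2 * (-Real.log x) + h + 6 * C with hQ
  have hQ0 : 0 < Q := by positivity
  set ρ : ℝ := min (1 / 2) (η / (16 * Q)) with hρ
  have hρ0 : 0 < ρ := lt_min (by norm_num) (by positivity)
  have hρ1 : ρ ≤ 1 / 2 := min_le_left _ _
  have hρQ : ρ * Q ≤ η / 16 := by
    have : ρ ≤ η / (16 * Q) := min_le_right _ _
    rw [le_div_iff₀ (by positivity)] at this
    linarith
  obtain ⟨m, h1, h2, h3, h4, h5⟩ := ((hg.eventually_le hρ0).and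
    ((eventually_linear_le_exp (a := 2 * (τ + 1)) (b := τ + 1) (c := η / 16) (by positivity)).and
    ((eventually_const_le (c := η / 16) (b := h * τ + 1) (by positivity)).and
    ((eventually_const_le (c := η / 16) (b := C * (5 + 2 * τ) + 1) (by positivity)).and
    (eventually_ge_atTop 1))))).exists
  have hk0 : (0 : ℝ) ≤ g m := Nat.cast_nonneg _
  have hm0 : (0 : ℝ) ≤ m := Nat.cast_nonneg _
  have hkm : (2 : ℝ) * g m ≤ m := by nlinarith
  have hQk : Q * g m ≤ η * m / 16 := by
    calc Q * g m ≤ Q * (ρ * m) := by gcongr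
      _ = (ρ * Q) * m := by ring
      _ ≤ η / 16 * m := by gcongr
      _ = _ := by ring
  have p1 : 0 ≤ (-Real.log x) * g m := by positivity
  have p2 : 0 ≤ h * g m := by positivity
  have p3 : 0 ≤ C * g m := by positivity
  have hQk' : 2 * g m + 2 * ((-Real.log x) * g m) + h * g m + 6 * (C * g m) ≤ η * m / 16 := by
    have : Q * g m = 2 * g m + 2 * ((-Real.log x) * g m) + h * g m + 6 * (C * g m) := by
      rw [hQ]; ring
    linarith
  set R : ℝ := 2 * g m * (-Real.log x) + x * (m + g m) + a * x * m with hR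
  have hRle : R ≤ η * m / 8 := by
    have h6 : x * (m + g m) + a * x * m ≤ η / 16 * m := by
      calc x * (m + g m) + a * x * m ≤ x * (m + m) + a * x * m := by
            have : (g m : ℝ) ≤ m := by linarith
            gcongr
        _ = (x * (2 + a)) * m := by ring
        _ ≤ _ := by gcongr
    have : 2 * (g m : ℝ) * (-Real.log x) = 2 * ((-Real.log x) * g m) := by ring
    linarith
  refine ⟨m, ⌊Real.exp R⌋₊, h5, by exact_mod_cast hkm, fun v hv => ?_, ?_, ?_, ?_⟩
  · obtain ⟨E, hE, hEc⟩ := exists_finset_editDist hx0 hx1 v m (g m)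
    refine ⟨E, hE, Nat.le_floor (hEc.trans (Real.exp_le_exp.2 ?_))⟩
    have : (v.length : ℝ) ≤ m + g m := by exact_mod_cast hv
    rw [hR]
    gcongr
  · have h6 : ((⌊Real.exp R⌋₊ : ℕ) : ℝ) ≤ Real.exp (η * m / 8) :=
      (Nat.floor_le (Real.exp_pos _).le).trans (Real.exp_le_exp.2 hRle)
    have h7 : ((m : ℝ) + g m + 1) * (τ + 1) ≤ Real.exp (η / 16 * m) := by
      refine le_trans ?_ h2
      have : (0 : ℝ) ≤ τ + 1 := by positivity
      nlinarith
    calc _ ≤ Real.exp (η / 16 * m) * Real.exp (η * m / 8) := by gcongr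
      _ ≤ _ := by
        rw [← Real.exp_add, Real.exp_le_exp]
        have : 0 ≤ η * m := by positivity
        linarith
  · rw [mul_add]; linarith
  · linarith

variable {X : Set (ℕ → A)} {G : Set (List A)} {τ : ℕ} {u : List A → List A → List A}

set_option maxHeartbeats 1000000 in
lemma exists_words (hXcl : IsClosed X) (hXinv : Set.MapsTo shift X X)
    (hu : ∀ v ∈ G, ∀ w ∈ G, (u v w).length ≤ τ ∧ v ++ u v w ++ w ∈ G)
    (happ : EditApproachable (language X) G) {μ : ProbabilityMeasure X}
    (hμ : IsInvariant (subShift X) μ) {ι : Type} [Fintype ι] {f : ι → X → ℝ}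
    (hf : ∀ i, Continuous (f i)) (hf0 : ∀ i, ∫ x, f i x ∂μ.toMeasure = 0) {η : ℝ} (hη : 0 < η)
    (hηh : η ≤ entropy X μ) (n₀ : ℕ) :
    ∃ (n : ℕ) (Γ : Finset (List A)), n₀ ≤ n ∧ (∀ w ∈ Γ, w ∈ G ∧ w.length = n ∧
      ∀ i, ∀ x : X, prefixWord x.1 n = w → |birkhoff (subShift X) (f i) n x| ≤ η * n) ∧
      Real.exp (n * (entropy X μ - η)) ≤ Γ.card := by
  obtain ⟨g, hg, hge⟩ := happ
  have hge' : ∀ w, ∃ v, w ∈ language X → v ∈ G ∧ editDist v w ≤ g w.length := by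
    intro w
    by_cases hw : w ∈ language X
    · obtain ⟨v, h1, h2⟩ := hge w hw
      exact ⟨v, fun _ => ⟨h1, h2⟩⟩
    · exact ⟨[], fun h => absurd h hw⟩
  choose e he using hge'
  have hB' : ∀ i, ∃ (B : List A → ℝ) (C : ℝ), AlmostAdditive B C ∧
      ∀ (x : X) (n : ℕ), |birkhoff (subShift X) (f i) n x - B (prefixWord x.1 n)| ≤
        η / 16 * n + C := fun i => exists_almostAdditive hXcl hXinv (hf i) (by positivity)
  choose B C' hB hBf using hB'
  set C : ℝ := ∑ i, C' i with hC
  have hCi : ∀ i, C' i ≤ C := fun i =>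
    Finset.single_le_sum (f := C') (fun j _ => (hB j).nonneg) (Finset.mem_univ i)
  have hC0 : 0 ≤ C := Finset.sum_nonneg fun j _ => (hB j).nonneg
  replace hB : ∀ i, AlmostAdditive (B i) C := fun i => (hB i).mono (hCi i)
  replace hBf : ∀ i (x : X) (n : ℕ), |birkhoff (subShift X) (f i) n x - B i (prefixWord x.1 n)| ≤
      η / 16 * n + C := fun i x n => (hBf i x n).trans (by linarith [hCi i])
  set h := entropy X μ with hh
  have hh0 : 0 ≤ h := entropy_nonneg μ
  obtain ⟨m, K, hm1, hkm, hK, hcnt, hent, herr⟩ := exists_edit_parameters (A := A) hg τ hh0 hC0 hη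
  set k := g m with hk
  have hmpos : (0 : ℝ) < m := by exact_mod_cast hm1
  obtain ⟨N₀, hN₀⟩ := exists_typical (Ω := Fin m → A) (p := cylMass μ)
    (fun w => cylMass_nonneg μ w) (sum_cylMass μ m) (fun i w => B i (List.ofFn w)) one_pos
  set L : ℝ := (m : ℝ) + k + τ with hL
  obtain ⟨N, hN1, hN2, hN3, hN4⟩ := ((eventually_ge_atTop N₀).and
    ((eventually_ge_atTop (2 * n₀)).and ((eventually_ge_atTop 1).and
    (eventually_linear_le_exp (a := 2 * L) (b := 2) (c := η * m / 2) (by positivity))))).exists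
  obtain ⟨J, rfl⟩ : ∃ J, N = J + 1 := ⟨N - 1, by omega⟩
  obtain ⟨T, hT, hTc⟩ := hN₀ _ hN1
  have hTne : T.Nonempty := by
    rw [← Finset.card_pos]
    have : (0 : ℝ) < T.card := lt_of_lt_of_le (by positivity) hTc
    exact_mod_cast this
  obtain ⟨n, Γ, hn1, hn2, hΓ, hTΓ⟩ := exists_glued_words hu (m := m) (k := k) (K := K) (e := e)
    (fun w hw hwm => by have := he w hw; rwa [hwm] at this) hK
    (fun w hw j => exists_of_cylMass_pos ((hT w hw).1 j)) hTne
  set M : ℝ := ((J + 1 : ℕ) : ℝ) with hM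
  have hM0 : 0 ≤ M := Nat.cast_nonneg _
  have hn1' : M * m ≤ n + M * k := by rw [hM]; exact_mod_cast hn1
  have hn2' : (n : ℝ) ≤ M * L := by rw [hM, hL]; exact_mod_cast hn2
  have hkm' : (2 : ℝ) * k ≤ m := by exact_mod_cast hkm
  have hMm : M * m ≤ 2 * n := by nlinarith
  refine ⟨n, Γ, ?_, fun V hV => ?_, ?_⟩
  · have h1 : (J + 1) * m ≤ 2 * n := by
      have : (((J + 1) * m : ℕ) : ℝ) ≤ ((2 * n : ℕ) : ℝ) := by
        push_cast
        have hMJ : M = J + 1 := by rw [hM]; push_cast; rfl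
        rwa [hMJ] at hMm
      exact_mod_cast this
    nlinarith
  · obtain ⟨hVG, hVn, w, hw, γ, hγ, hgap, rfl⟩ := hΓ V hV
    refine ⟨hVG, hVn, fun i x hx => ?_⟩
    have e1 := hBf i x n
    rw [hx] at e1
    have e2 := (hB i).abs_glue_sub_le hgap
    have e3 : |∑ j ∈ Finset.range (J + 1), B i (γ j) - ∑ j, B i (List.ofFn (w j))| ≤
        M * (6 * C * k) := by
      rw [← Fin.sum_univ_eq_sum_range (fun j => B i (γ j)), ← Finset.sum_sub_distrib]
      refine (Finset.abs_sum_le_sum_abs _ _).trans ?_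
      refine (Finset.sum_le_card_nsmul _ _ (6 * C * k) fun j _ => ?_).trans (by simp [hM])
      rw [hγ]
      have h1 := (he _ (exists_of_cylMass_pos ((hT w hw).1 j))).2
      refine ((hB i).abs_sub_le_of_editPath (editPath_editDist _ _)).trans ?_
      rw [List.length_ofFn] at h1
      have : (editDist (e (List.ofFn (w j))) (List.ofFn (w j)) : ℝ) ≤ k := by exact_mod_cast h1
      gcongr
    have e4 := (hT w hw).2 i
    have e5 := abs_sum_cylMass_mul_le hXcl hXinv hμ (hf i) (hf0 i) fun x => hBf i x m
    have e6 : |M * ∑ w : Fin m → A, cylMass μ w * B i (List.ofFn w)| ≤ M * (η / 16 * m + C) := by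
      rw [abs_mul, abs_of_nonneg hM0]
      gcongr
    have e7 : (J : ℝ) * (C * (3 + 2 * τ)) ≤ M * (C * (3 + 2 * τ)) := by
      have : (J : ℝ) ≤ M := by rw [hM]; push_cast; linarith
      gcongr
    have e8 : M * (6 * C * k + C * (5 + 2 * τ) + 1) ≤ M * (η * m / 8) := by gcongr
    have e9 : C ≤ M * C := by
      have : 1 ≤ M := by rw [hM]; exact_mod_cast hN3
      nlinarith
    have e10 : |birkhoff (subShift X) (f i) n x| ≤ (η / 16 * n + C) + M * (C * (3 + 2 * τ)) +
        M * (6 * C * k) + M * 1 + M * (η / 16 * m + C) := by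
      rw [abs_le] at *
      constructor <;> linarith [e1.1, e1.2, e2.1, e2.2, e3.1, e3.2, e4.1, e4.2, e6.1, e6.2]
    have e11 : η * (M * m) ≤ η * (2 * n) := by gcongr
    have e12 : 0 ≤ η * n := by positivity
    linarith
  · have c1 : (T.card : ℝ) ≤ Γ.card * (M * L + 1) * ((m + k + 1) * (τ + 1) * K) ^ (J + 1) := by
      rw [hM, hL]; exact_mod_cast hTΓ
    have c2 : (((m : ℝ) + k + 1) * (τ + 1) * K) ^ (J + 1) ≤ Real.exp (M * (η * m / 4)) := by
      rw [hM, Real.exp_nat_mul]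
      gcongr
    have c3 : M * (m * h - 1) ≤ M * (∑ w : Fin m → A, Real.negMulLog (cylMass μ w) - 1) := by
      have := entropy_mul_le μ m
      rw [wordEntropy_eq] at this
      gcongr
      linarith
    have hL0 : 0 ≤ L := by positivity
    have c4 : 1 / 2 * Real.exp (M * (m * h - 1)) ≤
        Γ.card * (M * L + 1) * Real.exp (M * (η * m / 4)) := by
      refine le_trans ?_ (hTc.trans (c1.trans ?_))
      · gcongr
      · gcongr
    have c5 : 2 * (M * L + 1) ≤ Real.exp (M * (η * m / 2)) := by
      refine le_trans (le_of_eq ?_) (hN4.trans (le_of_eq ?_))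
      · ring
      · congr 1; ring
    have c6 : n * (h - η) + M * (η * m / 2) + M * (η * m / 4) ≤ M * (m * h - 1) := by
      have d1 : n * (h - η) ≤ M * L * (h - η) := by
        have : 0 ≤ h - η := by linarith
        gcongr
      have d2 : M * (h * (k + τ) + 1) ≤ M * (η * m / 8) := by gcongr
      have d3 : M * L * (h - η) = M * (m * h) + M * (h * (k + τ)) - M * (η * m) -
        M * (η * (k + τ)) := by rw [hL]; ring
      have d4 : 0 ≤ M * (η * (k + τ)) := by positivity
      have d5 : 0 ≤ M * (η * m) := by positivity
      linarith
    have c7 : Real.exp (n * (h - η)) * Real.exp (M * (η * m / 2)) * Real.exp (M * (η * m / 4)) ≤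
        2 * (M * L + 1) * Γ.card * Real.exp (M * (η * m / 4)) := by
      rw [← Real.exp_add, ← Real.exp_add]
      have := Real.exp_le_exp.2 c6
      linarith
    have c8 := le_of_mul_le_mul_right c7 (Real.exp_pos _)
    have c9 : Real.exp (n * (h - η)) * Real.exp (M * (η * m / 2)) ≤
        Γ.card * Real.exp (M * (η * m / 2)) := by
      refine c8.trans ?_
      rw [mul_comm (Γ.card : ℝ)]
      gcongr
    exact le_of_mul_le_mul_right c9 (Real.exp_pos _)

end ManyWords

/-! ### A random concatenation of words -/

section Moran

/-- Independent uniform choices from a sequence of finite sets. -/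
lemma exists_independent_choice {B : Type} (Γ : ℕ → Finset B) (hΓ : ∀ i, (Γ i).Nonempty) :
    ∃ (Ω : Type) (_ : MeasurableSpace Ω) (P : Measure Ω) (γ : Ω → ℕ → B),
      IsProbabilityMeasure P ∧ (∀ ω i, γ ω i ∈ Γ i) ∧
      ∀ (J : ℕ) (b : ℕ → B), P {ω | ∀ j < J, γ ω j = b j} ≤
        ∏ j ∈ Finset.range J, ((Γ j).card : ℝ≥0∞)⁻¹ := by
  let : ∀ i, MeasurableSpace (Γ i) := fun _ => ⊤
  have : ∀ i, Nonempty (Γ i) := fun i => (hΓ i).to_subtype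
  refine ⟨∀ i, Γ i, inferInstance,
    Measure.infinitePi fun i => (PMF.uniformOfFintype (Γ i)).toMeasure, fun ω i => (ω i).1,
    inferInstance, fun ω i => (ω i).2, fun J b => ?_⟩
  have h1 : {ω : ∀ i, Γ i | ∀ j < J, (ω j).1 = b j} =
      Set.pi (Finset.range J) fun j => {a : Γ j | a.1 = b j} := by
    ext ω; simp [Set.mem_pi]
  rw [h1, Measure.infinitePi_pi _ fun i _ => MeasurableSpace.measurableSet_top]
  refine Finset.prod_le_prod' fun j _ => ?_
  rw [PMF.toMeasure_uniformOfFintype_apply _ MeasurableSpace.measurableSet_top,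
    ← one_div, Fintype.card_coe]
  refine ENNReal.div_le_div_right ?_ _
  have : Fintype.card {a : Γ j | a.1 = b j} ≤ 1 :=
    Fintype.card_le_one_iff.2 fun x y => Subtype.ext (Subtype.ext (x.2.trans y.2.symm))
  exact_mod_cast this

lemma exists_sum_range_le {a b : ℕ → ℝ} (h : ∀ᶠ j in atTop, a j ≤ b j) :
    ∃ C : ℝ, 0 ≤ C ∧ ∀ J, ∑ j ∈ Finset.range J, a j ≤ ∑ j ∈ Finset.range J, b j + C := by
  obtain ⟨N, hN⟩ := eventually_atTop.1 h
  refine ⟨∑ j ∈ Finset.range N, |a j - b j|, by positivity, fun J => ?_⟩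
  rw [← sub_le_iff_le_add', ← Finset.sum_sub_distrib]
  calc ∑ j ∈ Finset.range J, (a j - b j)
      ≤ ∑ j ∈ Finset.range J, if j ∈ Finset.range N then |a j - b j| else 0 := by
        refine Finset.sum_le_sum fun j _ => ?_
        split_ifs with hj
        · exact le_abs_self _
        · rw [Finset.mem_range, not_lt] at hj
          linarith [hN j hj]
    _ = ∑ j ∈ Finset.range J ∩ Finset.range N, |a j - b j| := by rw [Finset.sum_ite_mem]
    _ ≤ _ := Finset.sum_le_sum_of_subset_of_nonneg Finset.inter_subset_right
        fun _ _ _ => abs_nonneg _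

lemma exists_le_add_of_eventually {a b : ℕ → ℝ} (h : ∀ᶠ j in atTop, a j ≤ b j) :
    ∃ C : ℝ, 0 ≤ C ∧ ∀ J, a J ≤ b J + C := by
  obtain ⟨N, hN⟩ := eventually_atTop.1 h
  refine ⟨∑ j ∈ Finset.range N, |a j - b j|, by positivity, fun J => ?_⟩
  rcases lt_or_ge J N with hJ | hJ
  · have := Finset.single_le_sum (f := fun j => |a j - b j|) (fun j _ => abs_nonneg _)
      (Finset.mem_range.2 hJ)
    have h2 := le_abs_self (a J - b J)
    linarith
  · have : 0 ≤ ∑ j ∈ Finset.range N, |a j - b j| := by positivity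
    linarith [hN J hJ]

/-- Slowly growing sequences of levels. -/
lemma exists_slow_levels (N : ℕ → ℕ) (hN : ∀ k, k + 1 ≤ N k) :
    ∃ κ : ℕ → ℕ, Tendsto κ atTop atTop ∧ Tendsto (fun i => N (κ i)) atTop atTop ∧
      ∀ δ : ℝ, 0 < δ → ∀ᶠ i : ℕ in atTop, (N (κ i) : ℝ) ≤ δ * i := by
  set κ : ℕ → ℕ := fun i => Nat.findGreatest (fun k => k * N k ≤ i) i with hκ
  have hspec : ∀ i, κ i * N (κ i) ≤ i := fun i =>
    Nat.findGreatest_spec (P := fun k => k * N k ≤ i) (Nat.zero_le i) (by simp)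
  have hκt : Tendsto κ atTop atTop := by
    rw [tendsto_atTop]
    intro K
    filter_upwards [eventually_ge_atTop K, eventually_ge_atTop (K * N K)] with i h1 h2
    exact Nat.le_findGreatest h1 h2
  refine ⟨κ, hκt, tendsto_atTop_mono (fun i => (Nat.le_succ _).trans (hN (κ i))) hκt,
    fun δ hδ => ?_⟩
  filter_upwards [(tendsto_natCast_atTop_atTop (R := ℝ)).comp hκt |>.eventually_ge_atTop (1 / δ)]
    with i hi
  simp only [Function.comp, div_le_iff₀ hδ] at hi
  have h1 : (κ i : ℝ) * N (κ i) ≤ i := by exact_mod_cast hspec i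
  have h2 : (0 : ℝ) ≤ N (κ i) := Nat.cast_nonneg _
  nlinarith

variable {X : Set (ℕ → A)} {G : Set (List A)} {τ : ℕ} {u : List A → List A → List A}

lemma exists_point_of_glue (hXcl : IsClosed X) (hG : G ⊆ language X)
    (hu : ∀ v ∈ G, ∀ w ∈ G, (u v w).length ≤ τ ∧ v ++ u v w ++ w ∈ G)
    {γ : ℕ → List A} (hγ : ∀ j, γ j ∈ G) :
    ∃ x : X, ∀ J, prefixWord x.1 (glue u γ J).length = glue u γ J := by
  have : CompactSpace X := isCompact_iff_compactSpace.1 hXcl.isCompact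
  set S : ℕ → Set X := fun J => {x | prefixWord x.1 (glue u γ J).length = glue u γ J} with hS
  have hcl : ∀ J, IsClosed (S J) := fun J =>
    (isClosed_discrete {v : Fin (glue u γ J).length → A | List.ofFn v = glue u γ J}).preimage
      (continuous_initial _)
  have hne : (⋂ J, S J).Nonempty := by
    refine IsCompact.nonempty_iInter_of_sequence_nonempty_isCompact_isClosed S (fun J x hx => ?_)
      (fun J => ?_) (hcl 0).isCompact hcl
    · have hpre := glue_prefix (u := u) (γ := γ) (Nat.le_succ J)
      simp only [hS, mem_ofPred_eq] at hx ⊢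
      rw [← take_prefixWord x.1 hpre.length_le, hx]
      exact (List.prefix_iff_eq_take.1 hpre).symm
    · exact mem_language_iff.1 (hG (glue_mem hu fun j _ => hγ j))
  obtain ⟨x, hx⟩ := hne
  exact ⟨x, fun J => mem_iInter.1 hx J⟩

lemma abs_birkhoff_glue_le (hXinv : Set.MapsTo shift X X) {γ : ℕ → List A} {f : X → ℝ} {M : ℝ}
    (hM0 : 0 ≤ M) (hM : ∀ x, |f x| ≤ M) {c : ℕ → ℝ}
    (hc : ∀ j, ∀ x : X, prefixWord x.1 (γ j).length = γ j →
      |birkhoff (subShift X) f (γ j).length x| ≤ c j)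
    (hgap : ∀ j, (gap u γ j).length ≤ τ) {x : X} {J : ℕ}
    (hx : prefixWord x.1 (glue u γ J).length = glue u γ J) :
    |birkhoff (subShift X) f (glue u γ J).length x| ≤
      ∑ j ∈ Finset.range (J + 1), (c j + τ * M) := by
  induction J with
  | zero =>
    simp only [glue, zero_add, Finset.sum_range_one] at hx ⊢
    have := hc 0 x hx
    have : 0 ≤ τ * M := by positivity
    linarith
  | succ J ih =>
    rw [glue_succ, List.append_assoc, List.length_append, List.length_append] at hx ⊢
    rw [prefixWord_add] at hx
    obtain ⟨h1, h2⟩ := List.append_inj hx (length_prefixWord _ _)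
    rw [prefixWord_add] at h2
    obtain ⟨h3, h4⟩ := List.append_inj h2 (length_prefixWord _ _)
    rw [birkhoff_add, birkhoff_add, Finset.sum_range_succ]
    have e1 := ih h1
    have e2 := abs_birkhoff_le (subShift X) f hM (gap u γ J).length
      ((subShift X)^[(glue u γ J).length] x)
    have e3 := hc (J + 1) ((subShift X)^[(gap u γ J).length]
      ((subShift X)^[(glue u γ J).length] x)) (by
        rw [subShift_iterate_val hXinv, subShift_iterate_val hXinv]; exact h4)
    have e4 : ((gap u γ J).length : ℝ) * M ≤ τ * M := by
      have : ((gap u γ J).length : ℝ) ≤ τ := by exact_mod_cast hgap J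
      gcongr
    rw [abs_le] at *
    constructor <;> linarith [e1.1, e1.2, e2.1, e2.2, e3.1, e3.2]

end Moran

section Moran

variable {X : Set (ℕ → A)} {G : Set (List A)} {τ : ℕ} {u : List A → List A → List A}

lemma length_glue_le {γ : ℕ → List A} {ℓ : ℕ → ℕ} (hℓ : ∀ j, (γ j).length = ℓ j)
    (hgap : ∀ j, (gap u γ j).length ≤ τ) (J : ℕ) :
    ∑ j ∈ Finset.range (J + 1), ℓ j ≤ (glue u γ J).length ∧
      (glue u γ J).length ≤ ∑ j ∈ Finset.range (J + 1), (ℓ j + τ) := by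
  rw [length_glue]
  simp only [hℓ]
  refine ⟨Nat.le_add_right _ _, ?_⟩
  rw [Finset.sum_add_distrib]
  refine Nat.add_le_add_left ?_ _
  rw [Finset.sum_range_succ]
  exact (Finset.sum_le_sum fun j _ => hgap j).trans (Nat.le_add_right _ _)

lemma measure_setOf_prefixWord_le
    (hu : ∀ v ∈ G, ∀ w ∈ G, (u v w).length ≤ τ ∧ v ++ u v w ++ w ∈ G)
    {Ω : Type} [MeasurableSpace Ω] {P : Measure Ω} [IsProbabilityMeasure P] {γ : Ω → ℕ → List A}
    {ℓ : ℕ → ℕ} {q : ℕ → ℝ≥0∞} (hγG : ∀ ω j, γ ω j ∈ G) (hℓ : ∀ ω j, (γ ω j).length = ℓ j)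
    (hP : ∀ (J : ℕ) (b : ℕ → List A), P {ω | ∀ j < J, γ ω j = b j} ≤ ∏ j ∈ Finset.range J, q j)
    {x : Ω → X} (hx : ∀ ω J, prefixWord (x ω).1 (glue u (γ ω) J).length = glue u (γ ω) J)
    {J n : ℕ} (hJ : ∑ j ∈ Finset.range J, (ℓ j + τ) ≤ n) (w : List A) :
    P {ω | prefixWord (x ω).1 n = w} ≤ (τ + 1) ^ J * ∏ j ∈ Finset.range J, q j := by
  have hgap : ∀ ω j, (gap u (γ ω) j).length ≤ τ := fun ω j =>
    length_gap_le hu fun i _ => hγG ω i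
  rcases J with _ | J
  · simpa using prob_le_one
  set κ : Ω → Fin (J + 1) → Fin (τ + 1) := fun ω j => ⟨(gap u (γ ω) j).length, by
    have := hgap ω j; omega⟩ with hκ
  have hsub : {ω | prefixWord (x ω).1 n = w} ⊆
      ⋃ g, {ω | prefixWord (x ω).1 n = w ∧ κ ω = g} := fun ω hω =>
    mem_iUnion.2 ⟨κ ω, hω, rfl⟩
  have hpre : ∀ ω, prefixWord (x ω).1 n = w → glue u (γ ω) J <+: w := by
    intro ω hω
    have h1 := ((length_glue_le (u := u) (hℓ ω) (hgap ω) J).2).trans hJ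
    rw [List.prefix_iff_eq_take, ← hω, take_prefixWord _ h1, hx]
  have hg : ∀ g, P {ω | prefixWord (x ω).1 n = w ∧ κ ω = g} ≤
      ∏ j ∈ Finset.range (J + 1), q j := by
    intro g
    rcases Set.eq_empty_or_nonempty {ω | prefixWord (x ω).1 n = w ∧ κ ω = g} with h | ⟨ω₀, h1, h2⟩
    · rw [h, measure_empty]; exact zero_le
    · refine (measure_mono ?_).trans (hP (J + 1) (γ ω₀))
      rintro ω ⟨h3, h4⟩ j hj
      refine glue_injective (u := u) (J := J) (fun j _ => (hℓ ω j).trans (hℓ ω₀ j).symm)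
        (fun j hj => ?_) (hpre ω h3) (hpre ω₀ h1) j (by omega)
      exact congrArg Fin.val (congrFun (h4.trans h2.symm) ⟨j, by omega⟩)
  refine (measure_mono hsub).trans ((measure_iUnion_le _).trans ?_)
  rw [tsum_fintype]
  refine (Finset.sum_le_card_nsmul _ _ _ fun g _ => hg g).trans (le_of_eq ?_)
  simp

lemma exists_level {ℓ : ℕ → ℕ} (hℓ1 : ∀ j, 1 ≤ ℓ j) (τ n : ℕ) :
    ∃ J, ∑ j ∈ Finset.range J, (ℓ j + τ) ≤ n ∧ n < ∑ j ∈ Finset.range (J + 1), (ℓ j + τ) := by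
  induction n with
  | zero => exact ⟨0, by simp, by have := hℓ1 0; simp; omega⟩
  | succ n ih =>
    obtain ⟨J, h1, h2⟩ := ih
    by_cases h : n + 1 < ∑ j ∈ Finset.range (J + 1), (ℓ j + τ)
    · exact ⟨J, by omega, h⟩
    · refine ⟨J + 1, by omega, ?_⟩
      rw [Finset.sum_range_succ]
      have := hℓ1 (J + 1)
      omega

lemma exists_error_bound {ℓ : ℕ → ℕ} (hℓ1 : ∀ j, 1 ≤ ℓ j)
    (hslow : ∀ δ : ℝ, 0 < δ → ∀ᶠ i : ℕ in atTop, (ℓ i : ℝ) ≤ δ * i) (τ : ℕ) {a : ℕ → ℝ}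
    (ha : ∀ δ : ℝ, 0 < δ → ∀ᶠ i : ℕ in atTop, a i ≤ δ * ℓ i) {b : ℝ} (hb : 0 ≤ b) {δ : ℝ}
    (hδ : 0 < δ) : ∃ C : ℝ, ∀ n J : ℕ, ∑ j ∈ Finset.range J, (ℓ j + τ) ≤ n →
      ∑ j ∈ Finset.range J, a j + b * ℓ J ≤ δ * n + C := by
  obtain ⟨C₁, hC₁, h1⟩ := exists_sum_range_le (ha (δ / 2) (half_pos hδ))
  have h2 : ∀ᶠ i : ℕ in atTop, b * ℓ i ≤ δ / 2 * i := by
    filter_upwards [hslow (δ / (2 * (b + 1))) (by positivity)] with i hi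
    have h0 : (0 : ℝ) ≤ ℓ i := Nat.cast_nonneg _
    calc b * ℓ i ≤ (b + 1) * (δ / (2 * (b + 1)) * i) := by
          refine le_trans ?_ (mul_le_mul_of_nonneg_left hi (by positivity))
          linarith
      _ = δ / 2 * i := by field_simp
  obtain ⟨C₂, hC₂, h3⟩ := exists_le_add_of_eventually h2
  refine ⟨C₁ + C₂, fun n J hJ => ?_⟩
  have h4 : (∑ j ∈ Finset.range J, (ℓ j : ℝ)) ≤ n := by
    have : ∑ j ∈ Finset.range J, ℓ j ≤ n :=
      (Finset.sum_le_sum fun j _ => Nat.le_add_right _ _).trans hJ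
    exact_mod_cast this
  have h5 : (J : ℝ) ≤ n := by
    have : J ≤ ∑ j ∈ Finset.range J, ℓ j := by
      simpa using Finset.card_nsmul_le_sum (Finset.range J) ℓ 1 fun j _ => hℓ1 j
    have h6 : (J : ℝ) ≤ ∑ j ∈ Finset.range J, (ℓ j : ℝ) := by exact_mod_cast this
    linarith
  have h7 := h1 J
  rw [← Finset.mul_sum] at h7
  have h8 := h3 J
  have h9 : δ / 2 * (∑ j ∈ Finset.range J, (ℓ j : ℝ)) ≤ δ / 2 * n := by gcongr
  have h10 : δ / 2 * (J : ℝ) ≤ δ / 2 * n := by gcongr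
  linarith

/-- A family of points, parametrised by a probability space, along which the Birkhoff averages of
given functions converge uniformly and with exponentially small cylinder probabilities. -/
lemma exists_moran (hXcl : IsClosed X) (hXinv : Set.MapsTo shift X X) (hG : G ⊆ language X)
    (hu : ∀ v ∈ G, ∀ w ∈ G, (u v w).length ≤ τ ∧ v ++ u v w ++ w ∈ G)
    (happ : EditApproachable (language X) G) {μ : ProbabilityMeasure X}
    (hμ : IsInvariant (subShift X) μ) {ι : Type} [Fintype ι] {f : ι → X → ℝ}
    (hf : ∀ i, Continuous (f i)) (hf0 : ∀ i, ∫ x, f i x ∂μ.toMeasure = 0)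
    (hpos : 0 < entropy X μ) :
    ∃ (Ω : Type) (_ : MeasurableSpace Ω) (P : Measure Ω) (x : Ω → X), IsProbabilityMeasure P ∧
      (∀ i, ∀ δ : ℝ, 0 < δ → ∃ C : ℝ, ∀ ω n,
        |birkhoff (subShift X) (f i) n (x ω)| ≤ δ * n + C) ∧
      (∀ δ : ℝ, 0 < δ → ∃ C : ℝ, ∀ n w, P {ω | prefixWord (x ω).1 n = w} ≤
        ENNReal.ofReal (Real.exp (-(n * (entropy X μ - δ)) + C))) := by
  set h := entropy X μ with hh
  have hη : ∀ k : ℕ, 0 < h / (k + 2) ∧ h / (k + 2) ≤ h := fun k =>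
    ⟨by positivity, div_le_self hpos.le (by have : (0 : ℝ) ≤ k := Nat.cast_nonneg k; linarith)⟩
  choose N Γ' hN hΓ' hcard' using fun k : ℕ =>
    exists_words hXcl hXinv hu happ hμ hf hf0 (hη k).1 (hη k).2 (k + 1)
  obtain ⟨κ, hκ, hℓt, hslow⟩ := exists_slow_levels N hN
  set ℓ : ℕ → ℕ := fun i => N (κ i) with hℓ
  set Γ : ℕ → Finset (List A) := fun i => Γ' (κ i) with hΓ
  set ε : ℕ → ℝ := fun i => h / (κ i + 2) with hε
  have hℓ1 : ∀ j, 1 ≤ ℓ j := fun j => (Nat.le_add_left 1 _).trans (hN (κ j))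
  have hℓR : Tendsto (fun i => (ℓ i : ℝ)) atTop atTop := tendsto_natCast_atTop_atTop.comp hℓt
  have hε0 : Tendsto ε atTop (𝓝 0) :=
    ((tendsto_natCast_atTop_atTop.comp hκ).atTop_add tendsto_const_nhds).const_div_atTop h
  have herr : ∀ c δ : ℝ, 0 < δ → ∀ᶠ j in atTop, ε j * ℓ j + c ≤ δ * ℓ j := by
    intro c δ hδ
    filter_upwards [hε0.eventually (gt_mem_nhds (half_pos hδ)),
      (hℓR.const_mul_atTop (half_pos hδ)).eventually_ge_atTop c] with j h1 h2
    have h0 : (0 : ℝ) ≤ ℓ j := Nat.cast_nonneg _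
    nlinarith
  have hcard : ∀ j, Real.exp (ℓ j * (h - ε j)) ≤ (Γ j).card := fun j => hcard' (κ j)
  obtain ⟨Ω, _, P, γ, hPp, hγΓ, hP⟩ := exists_independent_choice Γ fun j => by
    rw [← Finset.card_pos]
    have : (0 : ℝ) < (Γ j).card := (Real.exp_pos _).trans_le (hcard j)
    exact_mod_cast this
  have hγG : ∀ ω j, γ ω j ∈ G := fun ω j => (hΓ' _ _ (hγΓ ω j)).1
  have hγℓ : ∀ ω j, (γ ω j).length = ℓ j := fun ω j => (hΓ' _ _ (hγΓ ω j)).2.1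
  have hgap : ∀ ω j, (gap u (γ ω) j).length ≤ τ := fun ω j =>
    length_gap_le hu fun i _ => hγG ω i
  choose x hx using fun ω => exists_point_of_glue hXcl hG hu (hγG ω)
  refine ⟨Ω, inferInstance, P, x, hPp, fun i δ hδ => ?_, fun δ hδ => ?_⟩
  · obtain ⟨M, hM0, hM⟩ := exists_abs_le hXcl (hf i)
    obtain ⟨C, hC⟩ := exists_error_bound hℓ1 hslow τ (herr (2 * (τ * M))) hM0 hδ
    refine ⟨C + τ * M, fun ω n => ?_⟩
    obtain ⟨J, hJ1, hJ2⟩ := exists_level hℓ1 τ n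
    suffices hs : |birkhoff (subShift X) (f i) n (x ω)| ≤
        ∑ j ∈ Finset.range J, (ε j * ℓ j + 2 * (τ * M)) + M * ℓ J + τ * M by
      linarith [hC n J hJ1]
    rw [Finset.sum_range_succ] at hJ2
    rcases J with _ | J
    · have h1 := abs_birkhoff_le (subShift X) (f i) hM n (x ω)
      have h2 : (n : ℝ) ≤ ℓ 0 + τ := by
        have : n ≤ ℓ 0 + τ := by simpa using hJ2.le
        exact_mod_cast this
      have h3 : (n : ℝ) * M ≤ (ℓ 0 + τ) * M := by gcongr
      simp only [Finset.range_zero, Finset.sum_empty]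
      linarith
    · obtain ⟨l1, l2⟩ := length_glue_le (u := u) (hγℓ ω) (hgap ω) J
      obtain ⟨r, hr⟩ := Nat.exists_eq_add_of_le (l2.trans hJ1)
      have h1 := abs_birkhoff_glue_le hXinv hM0 hM (c := fun j => ε j * ℓ j) (fun j y hy => by
        rw [hγℓ] at hy ⊢
        exact (hΓ' _ _ (hγΓ ω j)).2.2 i y hy) (hgap ω) (hx ω J)
      have h2 := abs_birkhoff_le (subShift X) (f i) hM r
        ((subShift X)^[(glue u (γ ω) J).length] (x ω))
      have h3 : (r : ℝ) ≤ (J + 1) * τ + ℓ (J + 1) + τ := by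
        have : r ≤ (J + 1) * τ + ℓ (J + 1) + τ := by
          rw [Finset.sum_add_distrib] at hJ2
          simp only [Finset.sum_const, Finset.card_range, smul_eq_mul] at hJ2
          omega
        exact_mod_cast this
      have h4 : (r : ℝ) * M ≤ ((J + 1) * τ + ℓ (J + 1) + τ) * M := by gcongr
      rw [hr, birkhoff_add]
      rw [Finset.sum_add_distrib] at h1 ⊢
      simp only [Finset.sum_const, Finset.card_range, nsmul_eq_mul] at h1 ⊢
      push_cast at h1 ⊢
      rw [abs_le] at *
      constructor <;> linarith [h1.1, h1.2, h2.1, h2.2]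
  · have hlog : 0 ≤ Real.log (τ + 1) := Real.log_nonneg (by simp)
    obtain ⟨C, hC⟩ := exists_error_bound hℓ1 hslow τ (herr (Real.log (τ + 1) + h * τ)) hpos.le hδ
    refine ⟨C + h * τ, fun n w => ?_⟩
    obtain ⟨J, hJ1, hJ2⟩ := exists_level hℓ1 τ n
    have h1 := measure_setOf_prefixWord_le hu hγG hγℓ hP hx hJ1 w
    refine h1.trans ?_
    have h2 : ∀ j, ((Γ j).card : ℝ≥0∞)⁻¹ ≤ ENNReal.ofReal (Real.exp (-(ℓ j * (h - ε j)))) := by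
      intro j
      rw [Real.exp_neg, ENNReal.ofReal_inv_of_pos (Real.exp_pos _), ENNReal.inv_le_inv]
      exact (ENNReal.ofReal_le_ofReal (hcard j)).trans (by simp)
    have h3 : ((τ : ℝ≥0∞) + 1) ^ J = ENNReal.ofReal (Real.exp (J * Real.log (τ + 1))) := by
      rw [Real.exp_nat_mul, Real.exp_log (by positivity), ENNReal.ofReal_pow (by positivity)]
      congr 1
      rw [ENNReal.ofReal_add (by positivity) zero_le_one]
      simp
    calc ((τ : ℝ≥0∞) + 1) ^ J * ∏ j ∈ Finset.range J, ((Γ j).card : ℝ≥0∞)⁻¹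
        ≤ ENNReal.ofReal (Real.exp (J * Real.log (τ + 1))) *
          ∏ j ∈ Finset.range J, ENNReal.ofReal (Real.exp (-(ℓ j * (h - ε j)))) := by
            rw [h3]
            exact mul_le_mul_right (Finset.prod_le_prod' fun j _ => h2 j) _
      _ = ENNReal.ofReal (Real.exp (J * Real.log (τ + 1) +
          ∑ j ∈ Finset.range J, -(ℓ j * (h - ε j)))) := by
            rw [← ENNReal.ofReal_prod_of_nonneg fun j _ => (Real.exp_pos _).le, ← Real.exp_sum,
              ← ENNReal.ofReal_mul (Real.exp_pos _).le, Real.exp_add]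
      _ ≤ _ := by
        refine ENNReal.ofReal_le_ofReal (Real.exp_le_exp.2 ?_)
        have e1 := hC n J hJ1
        have e2 : (n : ℝ) ≤ ∑ j ∈ Finset.range (J + 1), ((ℓ j : ℝ) + τ) := by
          exact_mod_cast hJ2.le
        rw [Finset.sum_range_succ, Finset.sum_add_distrib] at e2
        rw [Finset.sum_add_distrib] at e1
        have e3 : ∑ j ∈ Finset.range J, -(ℓ j * (h - ε j)) =
            ∑ j ∈ Finset.range J, ε j * ℓ j - h * ∑ j ∈ Finset.range J, (ℓ j : ℝ) := by
          rw [Finset.mul_sum, ← Finset.sum_sub_distrib]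
          exact Finset.sum_congr rfl fun j _ => by ring
        rw [e3]
        simp only [Finset.sum_const, Finset.card_range, nsmul_eq_mul] at e1 e2
        have e4 := mul_le_mul_of_nonneg_left e2 hpos.le
        linarith

end Moran

section LowerBound

variable {X : Set (ℕ → A)}

/-! ### Lower bound for the dimension -/

/-- The mass distribution principle. -/
lemma hMeas_ne_zero_of_mass {Y Ω : Type*} [MeasurableSpace Ω] {P : Measure Ω}
    [IsProbabilityMeasure P] {d : Y → Y → ℝ} {s : ℝ} {K : ℝ≥0∞} (hK : K ≠ ∞) {Z : Set Y}
    {x : Ω → Y} (hx : ∀ ω, x ω ∈ Z)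
    (h : ∀ D : Set Y, D.Nonempty → P (x ⁻¹' D) ≤ K * ediam d D ^ s) : hMeas d s Z ≠ 0 := by
  intro h0
  have h1 : hMeasAux d s 1 Z < 1 / K := by
    rw [(hMeas_eq_zero_iff d).1 h0 1 one_pos]
    simpa using hK
  obtain ⟨D, hD, -, hlt⟩ := exists_cover_of_hMeasAux_lt d h1
  have h2 : (1 : ℝ≥0∞) ≤ ∑' n, P (x ⁻¹' D n) := by
    rw [← measure_univ (μ := P)]
    refine (measure_mono fun ω _ => ?_).trans (measure_iUnion_le _)
    simpa using hD (hx ω)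
  have h3 : ∑' n, P (x ⁻¹' D n) ≤ K * ∑' n, (⨆ (_ : (D n).Nonempty), ediam d (D n) ^ s) := by
    rw [← ENNReal.tsum_mul_left]
    refine ENNReal.tsum_le_tsum fun n => ?_
    rcases (D n).eq_empty_or_nonempty with he | hne
    · simp [he]
    · simpa [hne] using h (D n) hne
  have h4 := ENNReal.mul_lt_of_lt_div hlt
  rw [mul_comm] at h4
  exact (h2.trans h3).not_gt h4

/-- Comparison of the mass of a set with its diameter, from bounds on cylinders. -/
lemma measure_preimage_le_ediam {Ω : Type*} [MeasurableSpace Ω] {P : Measure Ω} {φ : X → ℝ}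
    {x : Ω → X} {a b s C₁ C₂ : ℝ} (ha : 0 < a) (hs : 0 ≤ s) (hab : s * b ≤ a)
    (hP : ∀ n w, P {ω | prefixWord (x ω).1 n = w} ≤ ENNReal.ofReal (Real.exp (-(n * a) + C₁)))
    (hφ : ∀ (ω : Ω) (z : X) (n : ℕ), prefixWord z.1 n = prefixWord (x ω).1 n →
      birkhoff (subShift X) φ n z ≤ n * b + C₂) (D : Set X) :
    P (x ⁻¹' D) ≤ ENNReal.ofReal (Real.exp (C₁ + s * C₂)) * ediam (dphi X φ) D ^ s := by
  rcases (x ⁻¹' D).eq_empty_or_nonempty with he | ⟨ω₀, hω₀⟩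
  · simp [he]
  by_cases hall : ∀ ω ∈ x ⁻¹' D, x ω = x ω₀
  · have h0 : P (x ⁻¹' D) ≤ 0 := by
      have ht : Tendsto (fun n : ℕ => ENNReal.ofReal (Real.exp (-(n * a) + C₁))) atTop (𝓝 0) := by
        rw [← ENNReal.ofReal_zero]
        refine ENNReal.tendsto_ofReal (Real.tendsto_exp_atBot.comp ?_)
        refine tendsto_atBot_add_const_right _ _ (tendsto_neg_atTop_atBot.comp ?_)
        exact tendsto_natCast_atTop_atTop.atTop_mul_const ha
      refine ge_of_tendsto' ht fun n => (measure_mono fun ω hω => ?_).trans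
        (hP n (prefixWord (x ω₀).1 n))
      simp [hall ω hω]
    exact h0.trans bot_le
  · push Not at hall
    have hex : ∃ n, ∃ ω ∈ x ⁻¹' D, x ω ≠ x ω₀ ∧ wedge (x ω₀).1 (x ω).1 = n := by
      obtain ⟨ω, h1, h2⟩ := hall
      exact ⟨_, ω, h1, h2, rfl⟩
    obtain ⟨ω₁, hω₁, hne, hn⟩ := Nat.find_spec hex
    have hmin := fun m (hm : m < Nat.find hex) => Nat.find_min hex hm
    set n := Nat.find hex with hndef
    have h1 : P (x ⁻¹' D) ≤ ENNReal.ofReal (Real.exp (-(n * a) + C₁)) := by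
      refine (measure_mono fun ω hω => ?_).trans (hP n (prefixWord (x ω₀).1 n))
      by_cases heq : x ω = x ω₀
      · simp [heq]
      · have hle : n ≤ wedge (x ω₀).1 (x ω).1 := by
          by_contra hlt
          exact hmin _ (not_le.1 hlt) ⟨ω, hω, heq, rfl⟩
        have := prefixWord_eq_iff.1 (prefixWord_wedge (x := (x ω₀).1) (y := (x ω).1))
        exact prefixWord_eq_iff.2 fun i hi => (this i (hi.trans_le hle)).symm
    have h2 : ENNReal.ofReal (Real.exp (-(n * b + C₂))) ≤ ediam (dphi X φ) D := by
      refine le_trans (ENNReal.ofReal_le_ofReal ?_) (le_ediam (dphi X φ) hω₀ hω₁)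
      refine exp_neg_le_dphi hne.symm fun z hz => ?_
      rw [hn] at hz ⊢
      exact hφ ω₀ z n hz
    calc P (x ⁻¹' D) ≤ ENNReal.ofReal (Real.exp (-(n * a) + C₁)) := h1
      _ ≤ ENNReal.ofReal (Real.exp (C₁ + s * C₂)) *
          ENNReal.ofReal (Real.exp (-(n * b + C₂))) ^ s := by
        rw [ENNReal.ofReal_rpow_of_pos (Real.exp_pos _), ← Real.exp_mul,
          ← ENNReal.ofReal_mul (Real.exp_pos _).le, ← Real.exp_add]
        refine ENNReal.ofReal_le_ofReal (Real.exp_le_exp.2 ?_)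
        have := mul_le_mul_of_nonneg_left hab (Nat.cast_nonneg (α := ℝ) n)
        linarith
      _ ≤ _ := by gcongr

lemma le_integral (hXcl : IsClosed X) {φ : X → ℝ} (hφ : Continuous φ) {c : ℝ}
    (hcφ : ∀ x, c ≤ φ x) (μ : ProbabilityMeasure X) : c ≤ ∫ x, φ x ∂μ.toMeasure := by
  simpa using integral_mono (integrable_const c) (integrable_of_continuous hXcl μ hφ) hcφ

/-- The level set carries at least the dimension of each invariant measure. -/
lemma entropy_div_le_hdim (hXcl : IsClosed X) (hXinv : Set.MapsTo shift X X)
    {φ : X → ℝ} (hφ : Continuous φ) {G : Set (List A)}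
    (hG : G ⊆ language X) (hspec : HasSpecW (language X) G)
    (happ : EditApproachable (language X) G) {ψ : X → ℝ} (hψ : Continuous ψ) {α : ℝ}
    {μ : ProbabilityMeasure X} (hμ : IsInvariant (subShift X) μ)
    (hα : ∫ x, ψ x ∂μ.toMeasure = α) (hint : 0 < ∫ x, φ x ∂μ.toMeasure)
    (hne : ∃ s : ℝ, 0 ≤ s ∧ hMeas (dphi X φ) s (levelSet (subShift X) ψ α) = 0) :
    entropy X μ / ∫ x, φ x ∂μ.toMeasure ≤ hdim (dphi X φ) (levelSet (subShift X) ψ α) := by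
  set c := ∫ x, φ x ∂μ.toMeasure with hc
  rcases (entropy_nonneg μ).eq_or_lt with h0 | hpos
  · rw [← h0, zero_div]
    exact hdim_nonneg _
  obtain ⟨τ, hτ⟩ := hspec
  have hu : ∃ u : List A → List A → List A,
      ∀ v ∈ G, ∀ w ∈ G, (u v w).length ≤ τ ∧ v ++ u v w ++ w ∈ G := by
    have : ∀ v w : List A, ∃ u : List A, v ∈ G → w ∈ G → u.length ≤ τ ∧ v ++ u ++ w ∈ G := by
      intro v w
      by_cases hvw : v ∈ G ∧ w ∈ G
      · obtain ⟨u, -, h1, h2⟩ := hτ v hvw.1 w hvw.2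
        exact ⟨u, fun _ _ => ⟨h1, h2⟩⟩
      · exact ⟨[], fun h1 h2 => absurd ⟨h1, h2⟩ hvw⟩
    choose u hu using this
    exact ⟨u, fun v hv w hw => hu v w hv hw⟩
  obtain ⟨u, hu⟩ := hu
  obtain ⟨Ω, mΩ, P, x, hPp, hB, hP⟩ := exists_moran (τ := τ) (u := u) hXcl hXinv hG hu happ hμ
    (ι := Bool) (f := fun i => bif i then fun y => ψ y - α else fun y => φ y - c)
    (by
      rintro (_ | _)
      · exact hφ.sub continuous_const
      · exact hψ.sub continuous_const)
    (by
      rintro (_ | _)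
      · simp only [cond_false]
        rw [integral_sub (integrable_of_continuous hXcl μ hφ) (integrable_const _)]
        simp [hc]
      · simp only [cond_true]
        rw [integral_sub (integrable_of_continuous hXcl μ hψ) (integrable_const _)]
        simp [hα])
    hpos
  have hx : ∀ ω, x ω ∈ levelSet (subShift X) ψ α := by
    intro ω
    rw [levelSet, mem_ofPred_eq, Metric.tendsto_atTop]
    intro ε hε
    obtain ⟨C, hC⟩ := hB true (ε / 2) (half_pos hε)
    obtain ⟨N, hN⟩ := exists_nat_gt (2 * C / ε)
    refine ⟨N + 1, fun n hn => ?_⟩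
    have h1 := hC ω n
    simp only [cond_true, birkhoff_sub_const] at h1
    have hn0 : (0 : ℝ) < n := by exact_mod_cast (Nat.succ_pos N).trans_le hn
    have hnN : (N : ℝ) ≤ n := by exact_mod_cast (Nat.le_succ N).trans hn
    have h2 : C < ε / 2 * n := by
      rw [div_lt_iff₀ hε] at hN
      have := mul_le_mul_of_nonneg_right hnN hε.le
      linarith
    rw [Real.dist_eq, birkAvg]
    have h3 : (n : ℝ)⁻¹ * birkhoff (subShift X) ψ n (x ω) - α =
        (n : ℝ)⁻¹ * (birkhoff (subShift X) ψ n (x ω) - n * α) := by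
      field_simp
    rw [h3, abs_mul, abs_of_pos (inv_pos.2 hn0), inv_mul_lt_iff₀ hn0]
    linarith
  refine le_csInf hne ?_
  rintro s ⟨hs, hs0⟩
  by_contra hlt
  rw [not_le, lt_div_iff₀ hint] at hlt
  obtain ⟨δ, hδ, hδs⟩ : ∃ δ : ℝ, 0 < δ ∧ s * (c + 2 * δ) + δ = entropy X μ - δ := by
    refine ⟨(entropy X μ - s * c) / (2 * s + 2), div_pos (by linarith) (by linarith), ?_⟩
    have : (2 * s + 2) * ((entropy X μ - s * c) / (2 * s + 2)) = entropy X μ - s * c :=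
      mul_div_cancel₀ _ (by linarith : (2 * s + 2) ≠ 0)
    linarith
  have hb : 0 ≤ s * (c + 2 * δ) := by positivity
  obtain ⟨C₁, hC₁⟩ := hP δ hδ
  obtain ⟨C₂, hC₂⟩ := hB false δ hδ
  obtain ⟨C₃, -, hC₃⟩ := exists_birkhoff_sub_le hXcl hXinv hφ hδ
  refine hMeas_ne_zero_of_mass (P := P) (x := x) (K := ENNReal.ofReal
    (Real.exp (C₁ + s * (C₂ + C₃)))) ENNReal.ofReal_ne_top hx (fun D _ => ?_) hs0
  refine measure_preimage_le_ediam (a := entropy X μ - δ) (b := c + 2 * δ) (by linarith) hs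
    (by linarith) hC₁ (fun ω z n hz => ?_) D
  have h1 := (abs_le.1 (hC₂ ω n)).2
  simp only [cond_false, birkhoff_sub_const] at h1
  have h2 := (abs_le.1 (hC₃ z (x ω) n hz)).2
  linarith

/-- The ratios of entropy to the integral of a positive function are bounded. -/
lemma entropy_div_le (hXcl : IsClosed X) {φ : X → ℝ} (hφ : Continuous φ) {c : ℝ} (hc : 0 < c)
    (hcφ : ∀ x, c ≤ φ x) (μ : ProbabilityMeasure X) :
    entropy X μ / ∫ x, φ x ∂μ.toMeasure ≤ Fintype.card (Fin 1 → A) / c := by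
  have h1 : entropy X μ ≤ Fintype.card (Fin 1 → A) := by
    have h := entropy_mul_le μ 1
    rw [Nat.cast_one, mul_one, wordEntropy_eq] at h
    refine h.trans ((Finset.sum_le_card_nsmul _ _ 1 fun w _ => ?_).trans (by simp))
    exact (Real.negMulLog_le_one_sub_self (cylMass_nonneg μ w)).trans
      (by linarith [cylMass_nonneg μ w])
  exact div_le_div₀ (Nat.cast_nonneg _) h1 hc (le_integral hXcl hφ hcφ μ)

end LowerBound

/-- conditional variational principle for the Hausdorff dimension (w.r.t. the
metric `d_φ`) of level sets. -/
theorem statement_13 {A : Type} [Fintype A] [DecidableEq A] [TopologicalSpace A]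
    [DiscreteTopology A] [MeasurableSpace A] [BorelSpace A]
    (X : Set (ℕ → A)) (hXcl : IsClosed X) (hXinv : Set.MapsTo shift X X)
    (φ : ↥X → ℝ) (hφ : Continuous φ) (hφpos : ∀ x, 0 < φ x)
    (G : Set (List A)) (hG : G ⊆ language X)
    (hspec : HasSpecW (language X) G) (happ : EditApproachable (language X) G)
    (ψ : ↥X → ℝ) (hψ : Continuous ψ) (α : ℝ) :
    hdim (dphi X φ) (levelSet (subShift X) ψ α) =
      sSup {r : ℝ | ∃ μ : ProbabilityMeasure ↥X, IsInvariant (subShift X) μ ∧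
        (∫ x, ψ x ∂μ.toMeasure) = α ∧ r = entropy X μ / ∫ x, φ x ∂μ.toMeasure} := by
  obtain ⟨c, hc, hcφ⟩ := exists_pos_le hXcl hφ hφpos
  set S := {r : ℝ | ∃ μ : ProbabilityMeasure ↥X, IsInvariant (subShift X) μ ∧
    (∫ x, ψ x ∂μ.toMeasure) = α ∧ r = entropy X μ / ∫ x, φ x ∂μ.toMeasure} with hS
  have hpos : ∀ μ : ProbabilityMeasure X, 0 < ∫ x, φ x ∂μ.toMeasure := fun μ =>
    hc.trans_le (le_integral hXcl hφ hcφ μ)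
  have hbdd : BddAbove S := by
    refine ⟨Fintype.card (Fin 1 → A) / c, ?_⟩
    rintro _ ⟨μ, -, -, rfl⟩
    exact entropy_div_le hXcl hφ hc hcφ μ
  have hS0 : 0 ≤ sSup S := by
    refine Real.sSup_nonneg ?_
    rintro _ ⟨μ, -, -, rfl⟩
    exact div_nonneg (entropy_nonneg μ) (hpos μ).le
  have hzero : ∀ t, sSup S < t → hMeas (dphi X φ) t (levelSet (subShift X) ψ α) = 0 := by
    refine fun t ht => hMeas_levelSet_eq_zero hXcl hXinv hφ hφpos hψ (hS0.trans ht.le) ?_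
    intro μ hμ hα
    rw [← div_lt_iff₀ (hpos μ)]
    exact (le_csSup hbdd ⟨μ, hμ, hα, rfl⟩).trans_lt ht
  refine le_antisymm ?_ ?_
  · exact le_of_forall_gt_imp_ge_of_dense fun t ht => hdim_le _ (hS0.trans ht.le) (hzero t ht)
  · refine Real.sSup_le ?_ (hdim_nonneg _)
    rintro _ ⟨μ, hμ, hα, rfl⟩
    exact entropy_div_le_hdim hXcl hXinv hφ hG hspec happ hψ hμ hα (hpos μ)
      ⟨sSup S + 1, by linarith, hzero _ (by linarith)⟩

end Paper
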